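/- arXiv:2109.06009 — 4 statements merged into one kernel-verified Lean document; each statement's English description precedes it below -/
import Mathlib

section
/- Let n ≥ 2, let w_2,…,w_n ≥ 0 and define hypergraph weights α by α_A = w_{|A|} for every A ⊆ V with |A| ≥ 2 (and α_A = 0 otherwise). Then the one-particle entropy constant satisfies κ[α] = ∑_{ℓ=2}^n w_ℓ · C(n−1,ℓ−1) · log ℓ / log n. Precisely: (i) for every f : V → ℝ≥0, (∑_{ℓ=2}^n w_ℓ C(n−1,ℓ−1) log ℓ / log n) · Ent f ≤ (1/n) ∑_{A⊆V} |A| α_A ent_A f; (ii) for every x₀ ∈ V, the indicator f = 1_{x₀} achieves equality; and (iii) if w_ℓ > 0 for some ℓ ≤ n−1, then any f with Ent f ≠ 0 achieving equality is a positive multiple of the indicator of a single vertex. -/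
open Finset

namespace Stmt0

variable {V : Type*} [Fintype V] [DecidableEq V]

/-- Relative entropy of `f` w.r.t. the uniform distribution on `V`. -/
noncomputable def Ent (f : V → ℝ) : ℝ :=
  (1 / (Fintype.card V : ℝ)) *
    ∑ x, f x * Real.log (f x / ((∑ y, f y) / (Fintype.card V : ℝ)))

/-- Block entropy `ent_A f`. -/
noncomputable def entBlock (A : Finset V) (f : V → ℝ) : ℝ :=
  (1 / (A.card : ℝ)) *
    ∑ x ∈ A, f x * Real.log (f x / ((∑ y ∈ A, f y) / (A.card : ℝ)))

/-- The Dirichlet-type form `(1/n) ∑_{A ⊆ V} |A| α_A ent_A f`. -/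
noncomputable def Dform (α : Finset V → ℝ) (f : V → ℝ) : ℝ :=
  (1 / (Fintype.card V : ℝ)) * ∑ A : Finset V, (A.card : ℝ) * α A * entBlock A f

end Stmt0

namespace Stmt0

section Calculus

lemma strictConvexOn_of_hasDerivAt2_pos {D : Set ℝ} (hD : Convex ℝ D) {f f' f'' : ℝ → ℝ}
    (hf : ContinuousOn f D) (hf' : ∀ x ∈ interior D, HasDerivAt f (f' x) x)
    (hf'' : ∀ x ∈ interior D, HasDerivAt f' (f'' x) x) (hpos : ∀ x ∈ interior D, 0 < f'' x) :
    StrictConvexOn ℝ D f := by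
  refine strictConvexOn_of_deriv2_pos hD hf fun x hx => ?_
  have hev : deriv f =ᶠ[nhds x] f' := by
    filter_upwards [isOpen_interior.mem_nhds hx] with y hy using (hf' y hy).deriv
  have : deriv^[2] f x = f'' x := by
    simpa using hev.deriv_eq.trans (hf'' x hx).deriv
  rw [this]
  exact hpos x hx

lemma strictConcaveOn_of_hasDerivAt2_neg {D : Set ℝ} (hD : Convex ℝ D) {f f' f'' : ℝ → ℝ}
    (hf : ContinuousOn f D) (hf' : ∀ x ∈ interior D, HasDerivAt f (f' x) x)
    (hf'' : ∀ x ∈ interior D, HasDerivAt f' (f'' x) x) (hneg : ∀ x ∈ interior D, f'' x < 0) :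
    StrictConcaveOn ℝ D f := by
  rw [← neg_strictConvexOn_iff]
  exact strictConvexOn_of_hasDerivAt2_pos (f' := fun x => -f' x) (f'' := fun x => -f'' x) hD hf.neg
    (fun x hx => (hf' x hx).neg) (fun x hx => (hf'' x hx).neg)
    (fun x hx => neg_pos.2 (hneg x hx))

/-- Replacing two points by two more spread out ones with the same sum decreases the sum of the
values of a strictly concave function. -/
lemma _root_.StrictConcaveOn.add_lt_add_of_spread {D : Set ℝ} {f : ℝ → ℝ}
    (hf : StrictConcaveOn ℝ D f) {x y u v : ℝ} (hx : x ∈ D) (hy : y ∈ D) (hyv : y < v)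
    (hsum : u + v = x + y) (hvx : v < x) : f x + f y < f u + f v := by
  have hpos : 0 < x - y := by linarith
  have hne : x - y ≠ 0 := hpos.ne'
  have hxy : x ≠ y := by exact sub_ne_zero.1 hne
  have hyu : y < u := by linarith
  have h1 := hf.2 hx hy hxy (div_pos (sub_pos.2 hyu) hpos) (div_pos (sub_pos.2 hyv) hpos)
    (by field_simp; linarith)
  have h2 := hf.2 hx hy hxy (div_pos (sub_pos.2 hyv) hpos) (div_pos (sub_pos.2 hyu) hpos)
    (by field_simp; linarith)
  have e1 : ((u - y) / (x - y)) • x + ((v - y) / (x - y)) • y = u := by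
    obtain rfl : v = x + y - u := by linarith
    simp only [smul_eq_mul]; field_simp; ring
  have e2 : ((v - y) / (x - y)) • x + ((u - y) / (x - y)) • y = v := by
    obtain rfl : v = x + y - u := by linarith
    simp only [smul_eq_mul]; field_simp; ring
  rw [e1] at h1
  rw [e2] at h2
  have e3 : ((u - y) / (x - y)) • f x + ((v - y) / (x - y)) • f y +
      (((v - y) / (x - y)) • f x + ((u - y) / (x - y)) • f y) = f x + f y := by
    obtain rfl : v = x + y - u := by linarith
    simp only [smul_eq_mul]; field_simp; ring
  linarith

end Calculus

section EntropyGap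

/-- The summand of `∑ h(1 - pᵢ) - c ∑ h(pᵢ)`, where `h(t) = -t log t`. -/
noncomputable def entropyGap (c p : ℝ) : ℝ := Real.negMulLog (1 - p) - c * Real.negMulLog p

@[simp] lemma entropyGap_zero (c : ℝ) : entropyGap c 0 = 0 := by simp [entropyGap]

@[simp] lemma entropyGap_one (c : ℝ) : entropyGap c 1 = 0 := by simp [entropyGap]

@[fun_prop] lemma continuous_entropyGap (c : ℝ) : Continuous (entropyGap c) := by
  unfold entropyGap
  fun_prop

lemma hasDerivAt_entropyGap (c : ℝ) {p : ℝ} (h0 : p ≠ 0) (h1 : p ≠ 1) :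
    HasDerivAt (entropyGap c) (Real.log (1 - p) + c * Real.log p + (1 + c)) p := by
  have h1' : 1 - p ≠ 0 := sub_ne_zero.2 h1.symm
  have := ((Real.hasDerivAt_negMulLog h1').comp p ((hasDerivAt_id p).const_sub 1)).sub
    ((Real.hasDerivAt_negMulLog h0).const_mul c)
  refine this.congr_deriv ?_
  ring

lemma hasDerivAt_deriv_entropyGap (c : ℝ) {p : ℝ} (h0 : p ≠ 0) (h1 : p ≠ 1) :
    HasDerivAt (fun p => Real.log (1 - p) + c * Real.log p + (1 + c)) (c / p - 1 / (1 - p)) p := by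
  have h1' : 1 - p ≠ 0 := sub_ne_zero.2 h1.symm
  have := (((((hasDerivAt_id p).const_sub 1).log h1').add
    ((Real.hasDerivAt_log h0).const_mul c)).add_const (1 + c))
  refine this.congr_deriv ?_
  simp only [id]
  ring

lemma strictConvexOn_entropyGap {c : ℝ} (hc : 0 < c) :
    StrictConvexOn ℝ (Set.Icc 0 (c / (1 + c))) (entropyGap c) := by
  have key : ∀ x ∈ interior (Set.Icc 0 (c / (1 + c))), 0 < x ∧ x < 1 ∧ x * (1 + c) < c := by
    intro x hx
    rw [interior_Icc] at hx
    have h := (lt_div_iff₀ (by linarith)).1 hx.2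
    exact ⟨hx.1, by nlinarith [hx.1], h⟩
  refine strictConvexOn_of_hasDerivAt2_pos (convex_Icc _ _) (by fun_prop)
    (fun x hx => hasDerivAt_entropyGap c (key x hx).1.ne' (key x hx).2.1.ne)
    (fun x hx => hasDerivAt_deriv_entropyGap c (key x hx).1.ne' (key x hx).2.1.ne) fun x hx => ?_
  obtain ⟨h0, h1, h2⟩ := key x hx
  rw [sub_pos, div_lt_div_iff₀ (by linarith) h0]
  linarith

lemma strictConcaveOn_entropyGap {c : ℝ} (hc : 0 < c) :
    StrictConcaveOn ℝ (Set.Icc (c / (1 + c)) 1) (entropyGap c) := by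
  have key : ∀ x ∈ interior (Set.Icc (c / (1 + c)) 1), 0 < x ∧ x < 1 ∧ c < x * (1 + c) := by
    intro x hx
    rw [interior_Icc] at hx
    have h := (div_lt_iff₀ (by linarith)).1 hx.1
    exact ⟨lt_trans (by positivity) hx.1, hx.2, h⟩
  refine strictConcaveOn_of_hasDerivAt2_neg (convex_Icc _ _) (by fun_prop)
    (fun x hx => hasDerivAt_entropyGap c (key x hx).1.ne' (key x hx).2.1.ne)
    (fun x hx => hasDerivAt_deriv_entropyGap c (key x hx).1.ne' (key x hx).2.1.ne) fun x hx => ?_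
  obtain ⟨h0, h1, h2⟩ := key x hx
  rw [sub_neg, div_lt_div_iff₀ h0 (by linarith)]
  linarith

/-- The gap is positive on configurations `(a, …, a, b)` with `0 < a < b`. -/
lemma two_value_entropyGap_pos {k c a : ℝ} (hk : 2 ≤ k) (hc0 : 0 < c) (hc1 : c < 1)
    (hck : 1 < c * k) (hroot : entropyGap c (1 / (k + 1)) = 0) (ha0 : 0 < a)
    (ha : a < 1 / (k + 1)) : 0 < k * entropyGap c a + entropyGap c (1 - k * a) := by
  set g : ℝ → ℝ := fun x => k * entropyGap c x + entropyGap c (1 - k * x) with hg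
  set u := 1 / (k + 1) with hu
  have hku : 1 - k * u = u := by rw [hu]; field_simp; ring
  have hu0 : 0 < u := by positivity
  have hu1 : u < 1 / k := by rw [hu]; gcongr; linarith
  set t := (1 - c) / (k - c) with ht
  have hkc : 0 < k - c := by linarith
  have ht0 : 0 < t := div_pos (by linarith) hkc
  have htu : t < u := by
    rw [ht, hu, div_lt_div_iff₀ hkc (by linarith)]
    linarith
  have hdom : ∀ x, 0 < x → x < 1 / k → x < 1 ∧ 0 < 1 - k * x ∧ 1 - k * x < 1 := by
    intro x h0 h1
    rw [lt_div_iff₀ (by linarith)] at h1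
    exact ⟨by nlinarith, by linarith, by nlinarith⟩
  have hg1 : ∀ x, 0 < x → x < 1 / k → HasDerivAt g
      (k * (Real.log (1 - x) + c * Real.log x + (1 + c))
        - k * (Real.log (1 - (1 - k * x)) + c * Real.log (1 - k * x) + (1 + c))) x := by
    intro x h0 h1
    obtain ⟨h2, h3, h4⟩ := hdom x h0 h1
    have hlin : HasDerivAt (fun x => 1 - k * x) (-k) x := by
      simpa using ((hasDerivAt_id x).const_mul k).const_sub 1
    refine (((hasDerivAt_entropyGap c h0.ne' h2.ne).const_mul k).add
      ((hasDerivAt_entropyGap c h3.ne' h4.ne).comp x hlin)).congr_deriv ?_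
    ring
  have hg2 : ∀ x, 0 < x → x < 1 / k → HasDerivAt (fun x =>
      k * (Real.log (1 - x) + c * Real.log x + (1 + c))
        - k * (Real.log (1 - (1 - k * x)) + c * Real.log (1 - k * x) + (1 + c)))
      (k * (((k - c) * x - (1 - c)) / (x * (1 - x) * (1 - k * x)))) x := by
    intro x h0 h1
    obtain ⟨h2, h3, h4⟩ := hdom x h0 h1
    have hlin : HasDerivAt (fun x => 1 - k * x) (-k) x := by
      simpa using ((hasDerivAt_id x).const_mul k).const_sub 1
    have h5 : 1 - x ≠ 0 := by linarith
    have h6 : k ≠ 0 := by linarith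
    refine (((hasDerivAt_deriv_entropyGap c h0.ne' h2.ne).const_mul k).sub
      (((hasDerivAt_deriv_entropyGap c h3.ne' h4.ne).comp x hlin).const_mul k)).congr_deriv ?_
    have h7 : 1 - (1 - k * x) ≠ 0 := by nlinarith
    have h8 : 1 - (1 - k * x) = k * x := by ring
    rw [h8]
    have := h0.ne'
    have := h3.ne'
    field_simp
    ring
  have hgc : Continuous g := by simp only [hg]; fun_prop
  have hconc : StrictConcaveOn ℝ (Set.Icc 0 t) g := by
    have key : ∀ x ∈ interior (Set.Icc 0 t), 0 < x ∧ x < 1 / k ∧ x < t := by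
      intro x hx
      rw [interior_Icc] at hx
      exact ⟨hx.1, by linarith [hx.2], hx.2⟩
    refine strictConcaveOn_of_hasDerivAt2_neg (convex_Icc _ _) hgc.continuousOn
      (fun x hx => hg1 x (key x hx).1 (key x hx).2.1)
      (fun x hx => hg2 x (key x hx).1 (key x hx).2.1) fun x hx => ?_
    obtain ⟨h0, h1, h2⟩ := key x hx
    obtain ⟨h3, h4, -⟩ := hdom x h0 h1
    have h5 := (lt_div_iff₀ hkc).1 h2
    have h6 : 0 < x * (1 - x) * (1 - k * x) := mul_pos (mul_pos h0 (by linarith)) h4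
    exact mul_neg_of_pos_of_neg (by linarith) (div_neg_of_neg_of_pos (by linarith) h6)
  have hconv : StrictConvexOn ℝ (Set.Icc t u) g := by
    have key : ∀ x ∈ interior (Set.Icc t u), 0 < x ∧ x < 1 / k ∧ t < x := by
      intro x hx
      rw [interior_Icc] at hx
      exact ⟨by linarith [hx.1], by linarith [hx.2], hx.1⟩
    refine strictConvexOn_of_hasDerivAt2_pos (convex_Icc _ _) hgc.continuousOn
      (fun x hx => hg1 x (key x hx).1 (key x hx).2.1)
      (fun x hx => hg2 x (key x hx).1 (key x hx).2.1) fun x hx => ?_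
    obtain ⟨h0, h1, h2⟩ := key x hx
    obtain ⟨h3, h4, -⟩ := hdom x h0 h1
    have h5 := (div_lt_iff₀ hkc).1 h2
    have h6 : 0 < x * (1 - x) * (1 - k * x) := mul_pos (mul_pos h0 (by linarith)) h4
    exact mul_pos (by linarith) (div_pos (by linarith) h6)
  have hgu : g u = 0 := by simp only [hg, hku, hroot]; ring
  have hg0 : g 0 = 0 := by simp [hg]
  have hright : ∀ x, t ≤ x → x < u → 0 < g x := by
    intro x hx hxu
    have hd : HasDerivAt g 0 u := by
      refine (hg1 u hu0 hu1).congr_deriv ?_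
      rw [hku]
      ring
    have := hconv.slope_lt_of_hasDerivAt ⟨hx, hxu.le⟩ ⟨htu.le, le_rfl⟩ hxu hd
    rw [slope_def_field, hgu, div_lt_iff₀ (by linarith)] at this
    linarith
  rcases le_or_gt t a with hta | hta
  · exact hright a hta ha
  · have h := hconc.2 (Set.left_mem_Icc.2 ht0.le) (Set.right_mem_Icc.2 ht0.le) ht0.ne
      (sub_pos.2 ((div_lt_one ht0).2 hta)) (div_pos ha0 ht0) (sub_add_cancel 1 (a / t))
    have he : (1 - a / t) • (0 : ℝ) + (a / t) • t = a := by
      simp only [smul_eq_mul]; field_simp; ring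
    rw [he, hg0] at h
    simp only [smul_eq_mul, mul_zero, zero_add] at h
    exact (mul_pos (div_pos ha0 ht0) (hright t le_rfl htu)).trans h

end EntropyGap

end Stmt0

namespace Stmt0

section Simplex

variable {ι : Type*} [Fintype ι]

/-- A minimiser of a separable functional on the simplex is optimal for exchanges between two
coordinates. -/
lemma add_le_add_of_isMinOn_stdSimplex {φ : ℝ → ℝ} {p : ι → ℝ}
    (hp : p ∈ stdSimplex ℝ ι) (hmin : IsMinOn (fun q : ι → ℝ => ∑ i, φ (q i)) (stdSimplex ℝ ι) p)
    {i j : ι} (hij : i ≠ j) {x y : ℝ} (hx : 0 ≤ x) (hy : 0 ≤ y) (hxy : x + y = p i + p j) :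
    φ (p i) + φ (p j) ≤ φ x + φ y := by
  classical
  set q : ι → ℝ := Function.update (Function.update p i x) j y with hq
  have hqi : q i = x := by simp [hq, hij]
  have hqj : q j = y := by simp [hq]
  have hql : ∀ l ∈ (univ.erase i).erase j, q l = p l := by
    intro l hl
    simp only [mem_erase, mem_univ, and_true] at hl
    simp [hq, hl.1, hl.2]
  have hsplit : ∀ r : ι → ℝ, ∑ l, r l = r i + (r j + ∑ l ∈ (univ.erase i).erase j, r l) := by
    intro r
    rw [add_sum_erase _ _ (by simp [hij.symm]), add_sum_erase _ _ (mem_univ i)]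
  have hqmem : q ∈ stdSimplex ℝ ι := by
    refine ⟨fun l => ?_, ?_⟩
    · rcases eq_or_ne l j with rfl | hlj
      · rwa [hqj]
      rcases eq_or_ne l i with rfl | hli
      · rwa [hqi]
      rw [hql l (by simp [hlj, hli])]
      exact hp.1 l
    · have h1 := hp.2
      rw [hsplit] at h1
      rw [hsplit q, hqi, hqj, sum_congr rfl hql]
      linarith
  have h := hmin hqmem
  simp only [Set.mem_ofPred_eq] at h
  rw [hsplit (fun l => φ (p l)), hsplit (fun l => φ (q l)), hqi, hqj,
    sum_congr rfl fun l hl => congrArg φ (hql l hl)] at h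
  linarith

/-- A minimiser on the simplex of a separable functional whose summand is strictly convex, then
strictly concave, is constant except possibly at one point. -/
lemma isMinOn_stdSimplex_structure {φ : ℝ → ℝ} {t : ℝ} (ht0 : 0 ≤ t)
    (hconv : StrictConvexOn ℝ (Set.Icc 0 t) φ) (hconc : StrictConcaveOn ℝ (Set.Icc t 1) φ)
    {p : ι → ℝ} (hp : p ∈ stdSimplex ℝ ι)
    (hmin : IsMinOn (fun q : ι → ℝ => ∑ i, φ (q i)) (stdSimplex ℝ ι) p) :
    (∀ i j, p i = p j) ∨
      ∃ i₀, ∃ a ≤ t, t < p i₀ ∧ ∀ j, j ≠ i₀ → p j = a := by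
  classical
  have hlow : ∀ i j, p i ≤ t → p j ≤ t → p i = p j := by
    intro i j hi hj
    by_contra hne
    have hij : i ≠ j := fun h => hne (h ▸ rfl)
    have h := hconv.2 ⟨hp.1 i, hi⟩ ⟨hp.1 j, hj⟩ hne (half_pos one_pos) (half_pos one_pos)
      (add_halves 1)
    have hm : (1 / 2 : ℝ) • p i + (1 / 2 : ℝ) • p j = (p i + p j) / 2 := by
      simp only [smul_eq_mul]; ring
    rw [hm] at h
    simp only [smul_eq_mul] at h
    have hnn : 0 ≤ (p i + p j) / 2 := by linarith [hp.1 i, hp.1 j]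
    have := add_le_add_of_isMinOn_stdSimplex hp hmin hij hnn hnn (by ring)
    linarith
  have hhigh : ∀ i j, i ≠ j → p j ≤ p i → t < p j → False := by
    intro i j hij hle hj
    have hsum : p i + p j ≤ 1 := by
      rw [← hp.2, ← sum_pair hij]
      exact sum_le_sum_of_subset_of_nonneg (subset_univ _) fun l _ _ => hp.1 l
    set ε := min (p j - t) (1 - p i) with hε
    have hε0 : 0 < ε := lt_min (by linarith) (by linarith)
    have hε1 : ε ≤ p j - t := min_le_left _ _
    have hε2 : ε ≤ 1 - p i := min_le_right _ _
    have hlt := hconc.add_lt_add_of_spread (x := p i + ε) (y := p j - ε) (u := p i) (v := p j)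
      ⟨by linarith, by linarith⟩ ⟨by linarith, by linarith⟩ (by linarith) (by ring)
      (by linarith)
    have := add_le_add_of_isMinOn_stdSimplex hp hmin hij (x := p i + ε) (y := p j - ε)
      (by linarith) (by linarith) (by ring)
    linarith
  by_cases hex : ∃ i₀, t < p i₀
  · obtain ⟨i₀, hi₀⟩ := hex
    have hle : ∀ j, j ≠ i₀ → p j ≤ t := by
      intro j hj
      by_contra! hjt
      rcases le_total (p j) (p i₀) with h | h
      · exact hhigh i₀ j hj.symm h hjt
      · exact hhigh j i₀ hj h hi₀
    right
    by_cases hex' : ∃ j, j ≠ i₀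
    · obtain ⟨j, hj⟩ := hex'
      exact ⟨i₀, p j, hle j hj, hi₀, fun l hl => hlow l j (hle l hl) (hle j hj)⟩
    · push Not at hex'
      exact ⟨i₀, t, le_rfl, hi₀, fun j hj => absurd (hex' j) hj⟩
  · push Not at hex
    exact Or.inl fun i j => hlow i j (hex i) (hex j)

/-- `c_k` with `k = m - 1`: the sharp constant comparing `∑ h(1 - pᵢ)` and `∑ h(pᵢ)` on `m`
points. -/
noncomputable def gapConst (k : ℝ) : ℝ := k * Real.log ((k + 1) / k) / Real.log (k + 1)

lemma gapConst_lt_one {k : ℝ} (hk : 2 ≤ k) : gapConst k < 1 := by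
  have hlog : 1 < Real.log (k + 1) := by
    rw [Real.lt_log_iff_exp_lt (by linarith)]
    linarith [Real.exp_one_lt_d9]
  rw [gapConst, div_lt_one (by linarith)]
  have h := Real.log_lt_sub_one_of_pos (x := (k + 1) / k) (by positivity)
    (by rw [ne_eq, div_eq_one_iff_eq (by linarith)]; linarith)
  have : k * ((k + 1) / k - 1) = 1 := by field_simp; ring
  nlinarith

lemma one_lt_gapConst_mul {k : ℝ} (hk : 2 ≤ k) : 1 < gapConst k * k := by
  have hpos : 0 < Real.log (k + 1) := Real.log_pos (by linarith)
  rw [gapConst, div_mul_eq_mul_div, one_lt_div hpos]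
  have h1 : 1 / (k + 1) ≤ Real.log ((k + 1) / k) := by
    have := Real.one_sub_inv_le_log_of_pos (x := (k + 1) / k) (by positivity)
    have e : 1 - ((k + 1) / k)⁻¹ = 1 / (k + 1) := by field_simp; ring
    linarith
  have h2 : Real.log (k + 1) ≤ 0.368 * (k + 1) := by
    have h := Real.log_le_sub_one_of_pos (x := (k + 1) / Real.exp 1) (by positivity)
    rw [Real.log_div (by linarith) (Real.exp_pos 1).ne', Real.log_exp] at h
    have : (k + 1) / Real.exp 1 ≤ 0.368 * (k + 1) := by
      rw [div_le_iff₀ (Real.exp_pos 1)]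
      nlinarith [Real.exp_one_gt_d9]
    linarith
  have h3 : 0.368 * (k + 1) < k * (1 / (k + 1)) * k := by
    rw [mul_one_div, div_mul_eq_mul_div, lt_div_iff₀ (by linarith)]
    nlinarith
  have h4 : k * (1 / (k + 1)) * k ≤ k * Real.log ((k + 1) / k) * k := by gcongr
  linarith

lemma gapConst_pos {k : ℝ} (hk : 2 ≤ k) : 0 < gapConst k := by
  nlinarith [one_lt_gapConst_mul hk]

lemma entropyGap_gapConst {k : ℝ} (hk : 2 ≤ k) : entropyGap (gapConst k) (1 / (k + 1)) = 0 := by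
  have hpos : Real.log (k + 1) ≠ 0 := (Real.log_pos (by linarith)).ne'
  have h0 : k ≠ 0 := by linarith
  have h1 : k + 1 ≠ 0 := by linarith
  have e : 1 - 1 / (k + 1) = ((k + 1) / k)⁻¹ := by field_simp; ring
  rw [entropyGap, e, gapConst, Real.negMulLog, Real.negMulLog, Real.log_inv, one_div, Real.log_inv]
  field_simp
  ring

lemma isMinOn_entropyGap {k : ℝ} (hk : 2 ≤ k) (hcard : (Fintype.card ι : ℝ) = k + 1)
    {p : ι → ℝ} (hp : p ∈ stdSimplex ℝ ι)
    (hmin : IsMinOn (fun q : ι → ℝ => ∑ i, entropyGap (gapConst k) (q i)) (stdSimplex ℝ ι) p) :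
    0 ≤ ∑ i, entropyGap (gapConst k) (p i) ∧
      (∑ i, entropyGap (gapConst k) (p i) = 0 →
        (∀ i, p i = 1 / (k + 1)) ∨ ∃ i₀, ∀ j, j ≠ i₀ → p j = 0) := by
  classical
  have hc := gapConst_pos hk
  set c := gapConst k with hcdef
  rcases isMinOn_stdSimplex_structure (by positivity) (strictConvexOn_entropyGap hc)
    (strictConcaveOn_entropyGap hc) hp hmin with h | ⟨i₀, a, hat, hi₀, h⟩
  · have hu : ∀ i, p i = 1 / (k + 1) := by
      intro i
      have h1 := hp.2
      rw [sum_congr rfl fun j _ => h j i, sum_const, card_univ, nsmul_eq_mul, hcard] at h1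
      field_simp
      linarith
    refine ⟨le_of_eq ?_, fun _ => Or.inl hu⟩
    rw [hcdef, sum_congr rfl fun i _ => congrArg _ (hu i), sum_const, entropyGap_gapConst hk,
      smul_zero]
  · have hsplit : ∀ F : ℝ → ℝ, ∑ i, F (p i) = F (p i₀) + k * F a := by
      intro F
      rw [← add_sum_erase _ _ (mem_univ i₀),
        sum_congr rfl fun j hj => congrArg F (h j (ne_of_mem_erase hj)), sum_const,
        card_erase_of_mem (mem_univ _), card_univ, nsmul_eq_mul,
        Nat.cast_pred (Fintype.card_pos_iff.2 ⟨i₀⟩), hcard, add_sub_cancel_right]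
    have h1 : p i₀ = 1 - k * a := by
      have h1 := hsplit id
      simp only [id] at h1
      rw [hp.2] at h1
      linarith
    have hex : ∃ j, j ≠ i₀ := by
      have : 1 < Fintype.card ι := by
        have : (1 : ℝ) < Fintype.card ι := by linarith
        exact_mod_cast this
      exact Fintype.exists_ne_of_one_lt_card this i₀
    obtain ⟨j, hj⟩ := hex
    have ha : 0 ≤ a := h j hj ▸ hp.1 j
    rcases ha.eq_or_lt with rfl | ha0
    · refine ⟨le_of_eq ?_, fun _ => Or.inr ⟨i₀, h⟩⟩
      rw [hsplit, h1]
      simp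
    · have hpos : 0 < ∑ i, entropyGap c (p i) := by
        rw [hsplit, h1, add_comm]
        refine two_value_entropyGap_pos hk hc (gapConst_lt_one hk) (one_lt_gapConst_mul hk)
          (entropyGap_gapConst hk) ha0 ?_
        rw [lt_div_iff₀ (by linarith)]
        linarith
      exact ⟨hpos.le, fun h0 => absurd h0 hpos.ne'⟩

/-- On `m = k + 1 ≥ 3` points, `c_k ∑ h(pᵢ) ≤ ∑ h(1 - pᵢ)` for probability vectors `p`, with
equality only for the uniform vector and the point masses. -/
theorem sum_entropyGap_nonneg {k : ℝ} (hk : 2 ≤ k) (hcard : (Fintype.card ι : ℝ) = k + 1)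
    {p : ι → ℝ} (hp : p ∈ stdSimplex ℝ ι) :
    0 ≤ ∑ i, entropyGap (gapConst k) (p i) ∧
      (∑ i, entropyGap (gapConst k) (p i) = 0 →
        (∀ i, p i = 1 / (k + 1)) ∨ ∃ i₀, ∀ j, j ≠ i₀ → p j = 0) := by
  have hcont : Continuous fun q : ι → ℝ => ∑ i, entropyGap (gapConst k) (q i) := by fun_prop
  obtain ⟨q, hq, hmin⟩ := (isCompact_stdSimplex ℝ ι).exists_isMinOn ⟨p, hp⟩ hcont.continuousOn
  have h0 := (isMinOn_entropyGap hk hcard hq hmin).1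
  refine ⟨h0.trans (hmin hp), fun h => ?_⟩
  exact (isMinOn_entropyGap hk hcard hp fun r hr => by
    simp only [Set.mem_ofPred_eq, h]; exact h0.trans (hmin hr)).2 h

end Simplex

end Stmt0

namespace Stmt0

section Blocks

variable {V : Type*}

/-- The unnormalised block entropy `|A| ent_A f`. -/
noncomputable def blockSum (A : Finset V) (f : V → ℝ) : ℝ :=
  ∑ x ∈ A, f x * Real.log (f x / ((∑ y ∈ A, f y) / (A.card : ℝ)))

lemma card_mul_entBlock (A : Finset V) (f : V → ℝ) :
    (A.card : ℝ) * entBlock A f = blockSum A f := by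
  rcases A.eq_empty_or_nonempty with rfl | hA
  · simp [blockSum]
  · have : (A.card : ℝ) ≠ 0 := by exact_mod_cast hA.card_pos.ne'
    rw [entBlock, blockSum]
    field_simp

lemma Ent_eq_blockSum [Fintype V] (f : V → ℝ) :
    Ent f = (1 / (Fintype.card V : ℝ)) * blockSum univ f := by
  simp [Ent, blockSum]

lemma blockSum_eq_zero {A : Finset V} {f : V → ℝ} (h : ∀ x ∈ A, f x = 0) : blockSum A f = 0 :=
  sum_eq_zero fun x hx => by simp [h x hx]

lemma blockSum_eq {A : Finset V} (hA : A.Nonempty) {f : V → ℝ} (hf : ∀ x ∈ A, 0 ≤ f x) :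
    blockSum A f = Real.negMulLog (∑ x ∈ A, f x) - ∑ x ∈ A, Real.negMulLog (f x)
      + (∑ x ∈ A, f x) * Real.log A.card := by
  have hc : (A.card : ℝ) ≠ 0 := by exact_mod_cast hA.card_pos.ne'
  have key : ∀ x ∈ A, f x * Real.log (f x / ((∑ y ∈ A, f y) / (A.card : ℝ))) =
      f x * (Real.log A.card - Real.log (∑ y ∈ A, f y)) - Real.negMulLog (f x) := by
    intro x hx
    rcases (hf x hx).eq_or_lt with h0 | h0
    · simp [← h0]
    · have hs : 0 < ∑ y ∈ A, f y := h0.trans_le (single_le_sum hf hx)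
      rw [Real.log_div h0.ne' (by positivity), Real.log_div hs.ne' hc, Real.negMulLog]
      ring
  rw [blockSum, sum_congr rfl key, sum_sub_distrib, ← sum_mul, Real.negMulLog]
  ring

/-- The sum of the block entropies over blocks of size `ℓ`. -/
noncomputable def levelSum [Fintype V] (ℓ : ℕ) (f : V → ℝ) : ℝ := ∑ A ∈ powersetCard ℓ univ, blockSum A f

lemma levelSum_card [Fintype V] (f : V → ℝ) : levelSum (Fintype.card V) f = blockSum univ f := by
  rw [levelSum, ← card_univ, powersetCard_self, sum_singleton]

lemma Dform_eq_sum_levelSum [Fintype V] {α : Finset V → ℝ} {w : ℕ → ℝ}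
    (hα : ∀ A : Finset V, α A = if 2 ≤ A.card then w A.card else 0) (f : V → ℝ) :
    Dform α f = (1 / (Fintype.card V : ℝ)) *
      ∑ ℓ ∈ Icc 2 (Fintype.card V), w ℓ * levelSum ℓ f := by
  rw [Dform, ← powerset_univ, sum_powerset, card_univ]
  congr 1
  have hsub : Icc 2 (Fintype.card V) ⊆ range (Fintype.card V + 1) := fun ℓ h => by
    rw [mem_Icc] at h
    rw [mem_range]
    omega
  rw [← sum_subset hsub]
  · refine sum_congr rfl fun ℓ hℓ => ?_
    rw [levelSum, mul_sum]
    refine sum_congr rfl fun A hA => ?_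
    rw [hα, (mem_powersetCard.1 hA).2, if_pos (mem_Icc.1 hℓ).1, ← card_mul_entBlock,
      (mem_powersetCard.1 hA).2]
    ring
  · intro ℓ hℓ hℓ'
    refine sum_eq_zero fun A hA => ?_
    rw [mem_range] at hℓ
    rw [mem_Icc] at hℓ'
    rw [hα, (mem_powersetCard.1 hA).2, if_neg (by omega)]
    ring

variable [DecidableEq V]

lemma blockSum_indicator (A : Finset V) (x₀ : V) :
    blockSum A (fun x => if x = x₀ then (1 : ℝ) else 0) = if x₀ ∈ A then Real.log A.card else 0 := by
  split_ifs with h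
  · rw [blockSum, sum_eq_single x₀ (fun x _ hx => by simp [hx]) (fun h' => absurd h h')]
    simp [h]
  · exact blockSum_eq_zero fun x hx => if_neg (ne_of_mem_of_not_mem hx h)

lemma sum_blockSum_erase_sub {B : Finset V} {k : ℝ} (hk : 2 ≤ k) (hB : (B.card : ℝ) = k + 1)
    {f : V → ℝ} (hf : ∀ x, 0 ≤ f x) (hσ : 0 < ∑ x ∈ B, f x) :
    ∑ x ∈ B, blockSum (B.erase x) f - k * Real.log k / Real.log (k + 1) * blockSum B f =
      (∑ x ∈ B, f x) * ∑ x ∈ B, entropyGap (gapConst k) (f x / ∑ y ∈ B, f y) := by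
  set σ := ∑ x ∈ B, f x with hσdef
  set p : V → ℝ := fun x => f x / σ with hp
  set H := ∑ x ∈ B, Real.negMulLog (p x) with hH
  have hfp : ∀ x, f x = σ * p x := fun x => by rw [hp]; field_simp
  have hp1 : ∑ x ∈ B, p x = 1 := by rw [hp, ← sum_div, div_self hσ.ne']
  have hnml : ∀ x, Real.negMulLog (f x) = p x * Real.negMulLog σ + σ * Real.negMulLog (p x) :=
    fun x => by rw [hfp, Real.negMulLog_mul]
  have hHf : ∑ x ∈ B, Real.negMulLog (f x) = Real.negMulLog σ + σ * H := by
    rw [sum_congr rfl fun x _ => hnml x, sum_add_distrib, ← sum_mul, ← mul_sum, hp1, one_mul]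
  have hBne : B.Nonempty := by
    rw [← card_pos]
    have : (0 : ℝ) < B.card := by linarith
    exact_mod_cast this
  have hSB : blockSum B f = σ * (Real.log (k + 1) - H) := by
    rw [blockSum_eq hBne fun x _ => hf x, ← hσdef, hHf, hB]
    ring
  have hSe : ∀ x ∈ B, blockSum (B.erase x) f =
      σ * (Real.negMulLog (1 - p x) - H + Real.negMulLog (p x) + (1 - p x) * Real.log k) := by
    intro x hx
    have hc : ((B.erase x).card : ℝ) = k := by
      rw [card_erase_of_mem hx, Nat.cast_pred hBne.card_pos, hB]
      ring
    have hne : (B.erase x).Nonempty := by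
      rw [← card_pos]
      have : (0 : ℝ) < (B.erase x).card := by linarith
      exact_mod_cast this
    have hs : ∑ y ∈ B.erase x, f y = σ * (1 - p x) := by
      rw [sum_erase_eq_sub hx, mul_sub, ← hfp, mul_one]
    rw [blockSum_eq hne fun x _ => hf x, hc, hs, Real.negMulLog_mul, sum_erase_eq_sub hx, hHf,
      hnml x]
    ring
  have hlog : Real.log (k + 1) ≠ 0 := (Real.log_pos (by linarith)).ne'
  have hS : ∑ x ∈ B, blockSum (B.erase x) f =
      σ * (∑ x ∈ B, Real.negMulLog (1 - p x) - k * H + k * Real.log k) := by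
    rw [sum_congr rfl hSe, ← mul_sum, sum_add_distrib, sum_add_distrib, sum_sub_distrib, ← sum_mul,
      sum_sub_distrib, hp1, sum_const, sum_const, nsmul_eq_mul, nsmul_eq_mul, hB, ← hH]
    ring
  change _ = σ * ∑ x ∈ B, (Real.negMulLog (1 - p x) - gapConst k * Real.negMulLog (p x))
  rw [sum_sub_distrib, ← mul_sum, ← hH, hS, hSB, gapConst,
    Real.log_div (by linarith) (by linarith)]
  clear_value p
  field_simp
  ring

/-- Comparison of the block entropy of `B` with those of the blocks obtained by deleting a point,
together with the equality cases. -/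
lemma le_sum_blockSum_erase {B : Finset V} {k : ℝ} (hk : 2 ≤ k) (hB : (B.card : ℝ) = k + 1)
    {f : V → ℝ} (hf : ∀ x, 0 ≤ f x) :
    k * Real.log k / Real.log (k + 1) * blockSum B f ≤ ∑ x ∈ B, blockSum (B.erase x) f ∧
      (k * Real.log k / Real.log (k + 1) * blockSum B f = ∑ x ∈ B, blockSum (B.erase x) f →
        blockSum B f ≠ 0 → ∃ x₀ ∈ B, ∀ x ∈ B, x ≠ x₀ → f x = 0) := by
  rcases (sum_nonneg fun x (_ : x ∈ B) => hf x).eq_or_lt with h0 | hσ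
  · have hz : ∀ x ∈ B, f x = 0 := (sum_eq_zero_iff_of_nonneg fun x _ => hf x).1 h0.symm
    have hzB := blockSum_eq_zero hz
    refine ⟨?_, fun _ h => absurd hzB h⟩
    rw [hzB, sum_eq_zero fun x _ => blockSum_eq_zero fun y hy => hz y (mem_of_mem_erase hy),
      mul_zero]
  · have hid := sum_blockSum_erase_sub hk hB hf hσ
    set σ := ∑ x ∈ B, f x with hσdef
    have hp : (fun x : B => f x / σ) ∈ stdSimplex ℝ B := by
      refine ⟨fun x => div_nonneg (hf x) hσ.le, ?_⟩
      rw [sum_coe_sort B fun x => f x / σ, ← sum_div, div_self hσ.ne']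
    obtain ⟨h1, h2⟩ := sum_entropyGap_nonneg hk (by rw [Fintype.card_coe, hB]) hp
    rw [sum_coe_sort B fun x => entropyGap (gapConst k) (f x / σ)] at h1 h2
    refine ⟨by linarith [mul_nonneg hσ.le h1], fun heq hne => ?_⟩
    have hz : ∑ x ∈ B, entropyGap (gapConst k) (f x / σ) = 0 := by
      rw [heq, sub_self] at hid
      exact (mul_eq_zero.1 hid.symm).resolve_left hσ.ne'
    rcases h2 hz with h | ⟨i₀, h⟩
    · refine absurd (sum_eq_zero fun x hx => ?_) hne
      have hx' : f x / σ = 1 / (k + 1) := h ⟨x, hx⟩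
      rw [← hσdef, hB, div_div_eq_mul_div, mul_div_right_comm, hx',
        div_mul_cancel₀ _ (by linarith), Real.log_one, mul_zero]
    · refine ⟨i₀, i₀.2, fun x hx hne => ?_⟩
      have := h ⟨x, hx⟩ fun h => hne (congrArg Subtype.val h)
      exact (div_eq_zero_iff.1 this).resolve_right hσ.ne'

variable [Fintype V]

lemma sum_powersetCard_succ_sum_erase (G : Finset V → ℝ) {ℓ : ℕ} (hℓ : ℓ ≤ Fintype.card V) :
    ∑ B ∈ powersetCard (ℓ + 1) univ, ∑ x ∈ B, G (B.erase x) =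
      ((Fintype.card V : ℝ) - ℓ) * ∑ A ∈ powersetCard ℓ univ, G A := by
  have h : ∀ A ∈ powersetCard ℓ (univ : Finset V),
      ((Fintype.card V : ℝ) - ℓ) * G A = ∑ _x ∈ Aᶜ, G A := by
    intro A hA
    rw [sum_const, card_compl, (mem_powersetCard.1 hA).2, nsmul_eq_mul, Nat.cast_sub hℓ]
  rw [mul_sum, sum_congr rfl h, sum_sigma', sum_sigma']
  refine sum_bij' (fun s _ => ⟨s.1.erase s.2, s.2⟩) (fun s _ => ⟨insert s.2 s.1, s.2⟩) ?_ ?_ ?_ ?_ ?_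
  · rintro ⟨B, x⟩ h
    simp only [mem_sigma, mem_powersetCard, subset_univ, true_and] at h
    simp [card_erase_of_mem h.2, h.1]
  · rintro ⟨A, x⟩ h
    simp only [mem_sigma, mem_powersetCard, subset_univ, true_and, mem_compl] at h
    simp [card_insert_of_notMem h.2, h.1]
  · rintro ⟨B, x⟩ h
    simp only [mem_sigma] at h
    simp [insert_erase h.2]
  · rintro ⟨A, x⟩ h
    simp only [mem_sigma, mem_compl] at h
    simp [erase_insert h.2]
  · intro s _
    rfl

/-- The value `C(n-1, ℓ-1) log ℓ` of `levelSum ℓ` at the indicator of a point. -/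
noncomputable def levelWeight (n ℓ : ℕ) : ℝ := (Nat.choose (n - 1) (ℓ - 1) : ℝ) * Real.log ℓ

lemma levelWeight_pos {n ℓ : ℕ} (h2 : 2 ≤ ℓ) (hn : ℓ ≤ n) : 0 < levelWeight n ℓ := by
  have h1 : (0 : ℝ) < Nat.choose (n - 1) (ℓ - 1) := by
    exact_mod_cast Nat.choose_pos (by omega)
  exact mul_pos h1 (Real.log_pos (by exact_mod_cast h2))

lemma le_sub_mul_levelSum {f : V → ℝ} (hf : ∀ x, 0 ≤ f x) {ℓ : ℕ} (h2 : 2 ≤ ℓ)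
    (hn : ℓ ≤ Fintype.card V) :
    ℓ * Real.log ℓ / Real.log (ℓ + 1) * levelSum (ℓ + 1) f ≤
      ((Fintype.card V : ℝ) - ℓ) * levelSum ℓ f := by
  rw [levelSum, levelSum, ← sum_powersetCard_succ_sum_erase (fun A => blockSum A f) hn, mul_sum]
  refine sum_le_sum fun B hB => (le_sum_blockSum_erase (by exact_mod_cast h2) ?_ hf).1
  rw [(mem_powersetCard.1 hB).2]
  push_cast
  rfl

lemma sub_mul_levelWeight {n ℓ : ℕ} (h2 : 2 ≤ ℓ) (hn : ℓ < n) :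
    ((n : ℝ) - ℓ) * levelWeight n ℓ =
      ℓ * Real.log ℓ / Real.log (ℓ + 1) * levelWeight n (ℓ + 1) := by
  obtain ⟨j, rfl⟩ : ∃ j, ℓ = j + 1 := ⟨ℓ - 1, by omega⟩
  obtain ⟨N, rfl⟩ : ∃ N, n = N + 1 := ⟨n - 1, by omega⟩
  have hjN : j ≤ N := by omega
  have hch : ((N.choose (j + 1) : ℕ) : ℝ) * (j + 1) = (N.choose j : ℝ) * ((N : ℝ) - j) := by
    rw [← Nat.cast_sub hjN]
    exact_mod_cast Nat.choose_succ_right_eq N j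
  have hlog : Real.log ((j : ℝ) + 1 + 1) ≠ 0 := (Real.log_pos (by
    have : (0 : ℝ) ≤ j := j.cast_nonneg
    linarith)).ne'
  simp only [levelWeight, Nat.add_sub_cancel]
  push_cast
  field_simp
  linear_combination -Real.log ((j : ℝ) + 1) * hch

/-- The ratios of `levelSum ℓ` at `f` and at the indicator of a point are antitone in `ℓ`. -/
lemma levelSum_div_antitone {f : V → ℝ} (hf : ∀ x, 0 ≤ f x) {a b : ℕ} (ha : 2 ≤ a) (hab : a ≤ b)
    (hb : b ≤ Fintype.card V) :
    levelSum b f / levelWeight (Fintype.card V) b ≤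
      levelSum a f / levelWeight (Fintype.card V) a := by
  induction b, hab using Nat.le_induction with
  | base => exact le_rfl
  | succ ℓ haℓ ih =>
    refine le_trans ?_ (ih (by omega))
    have h2 : 2 ≤ ℓ := by omega
    have hw := levelWeight_pos h2 (by omega : ℓ ≤ Fintype.card V)
    have hw' := levelWeight_pos (by omega : 2 ≤ ℓ + 1) hb
    have hpos : (0 : ℝ) < (Fintype.card V : ℝ) - ℓ := by
      have : (ℓ : ℝ) + 1 ≤ Fintype.card V := by exact_mod_cast hb
      linarith
    have hstep := le_sub_mul_levelSum hf h2 (by omega : ℓ ≤ Fintype.card V)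
    have hid := sub_mul_levelWeight h2 (by omega : ℓ < Fintype.card V)
    rw [div_le_div_iff₀ hw' hw]
    refine le_of_mul_le_mul_left ?_ hpos
    calc ((Fintype.card V : ℝ) - ℓ) * (levelSum (ℓ + 1) f * levelWeight (Fintype.card V) ℓ)
        = ℓ * Real.log ℓ / Real.log (ℓ + 1) * levelSum (ℓ + 1) f
            * levelWeight (Fintype.card V) (ℓ + 1) := by linear_combination levelSum (ℓ + 1) f * hid
      _ ≤ ((Fintype.card V : ℝ) - ℓ) * levelSum ℓ f * levelWeight (Fintype.card V) (ℓ + 1) := by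
          gcongr
      _ = _ := by ring

lemma exists_eq_zero_of_levelSum_div_eq {f : V → ℝ} (hf : ∀ x, 0 ≤ f x) {ℓ : ℕ} (h2 : 2 ≤ ℓ)
    (hℓ : ℓ < Fintype.card V)
    (heq : levelSum ℓ f / levelWeight (Fintype.card V) ℓ =
      levelSum (Fintype.card V) f / levelWeight (Fintype.card V) (Fintype.card V))
    (hne : blockSum univ f ≠ 0) : ∃ x₀, ∀ x, x ≠ x₀ → f x = 0 := by
  obtain ⟨m, hm⟩ : ∃ m, Fintype.card V = m + 1 := ⟨Fintype.card V - 1, by omega⟩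
  have h2m : 2 ≤ m := by omega
  have hA := levelSum_div_antitone hf h2 (by omega : ℓ ≤ m) (by omega)
  have hB := levelSum_div_antitone hf h2m (by omega : m ≤ m + 1) (by omega)
  rw [heq] at hA
  have hw := levelWeight_pos h2m (by omega : m ≤ Fintype.card V)
  have hw' := levelWeight_pos (by omega : 2 ≤ m + 1) hm.ge
  have hid := sub_mul_levelWeight h2m (by omega : m < Fintype.card V)
  have hcount := sum_powersetCard_succ_sum_erase (fun A => blockSum A f)
    (by omega : m ≤ Fintype.card V)
  have hcast : (Fintype.card V : ℝ) = m + 1 := by rw [hm]; push_cast; rfl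
  rw [← hm, ← card_univ, powersetCard_self, sum_singleton, card_univ, ← levelSum] at hcount
  rw [show (m + 1) = Fintype.card V from hm.symm] at hB
  have hE := le_antisymm hA hB
  rw [← hm] at hw' hid
  rw [div_eq_div_iff hw.ne' hw'.ne', levelSum_card] at hE
  have hstep := (le_sum_blockSum_erase (B := univ) (k := m) (by exact_mod_cast h2m)
    (by rw [card_univ, hcast]) hf).2
  obtain ⟨x₀, -, h⟩ := hstep (by
    rw [hcount]
    refine mul_right_cancel₀ hw'.ne' ?_
    linear_combination -blockSum univ f * hid - ((Fintype.card V : ℝ) - m) * hE) hne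
  exact ⟨x₀, fun x hx => h x (mem_univ x) hx⟩

lemma card_filter_mem_powersetCard (x₀ : V) (ℓ : ℕ) :
    {A ∈ powersetCard (ℓ + 1) (univ : Finset V) | x₀ ∈ A}.card = (Fintype.card V - 1).choose ℓ := by
  have h : (univ.erase x₀).card = Fintype.card V - 1 := by
    rw [card_erase_of_mem (mem_univ _), card_univ]
  rw [← h, ← card_powersetCard]
  refine card_bij' (fun A _ => A.erase x₀) (fun A _ => insert x₀ A) ?_ ?_ ?_ ?_
  · intro A hA
    simp only [mem_filter, mem_powersetCard, subset_univ, true_and] at hA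
    rw [mem_powersetCard, card_erase_of_mem hA.2, hA.1]
    exact ⟨erase_subset_erase _ (subset_univ _), rfl⟩
  · intro A hA
    rw [mem_powersetCard] at hA
    have hx : x₀ ∉ A := fun h' => notMem_erase x₀ univ (hA.1 h')
    simp [card_insert_of_notMem hx, hA.2]
  · intro A hA
    exact insert_erase (mem_filter.1 hA).2
  · intro A hA
    exact erase_insert fun h' => notMem_erase x₀ univ ((mem_powersetCard.1 hA).1 h')

lemma levelSum_indicator (x₀ : V) {ℓ : ℕ} (hℓ : 1 ≤ ℓ) :
    levelSum ℓ (fun x => if x = x₀ then (1 : ℝ) else 0) = levelWeight (Fintype.card V) ℓ := by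
  obtain ⟨j, rfl⟩ : ∃ j, ℓ = j + 1 := ⟨ℓ - 1, by omega⟩
  have h : ∀ A ∈ powersetCard (j + 1) (univ : Finset V),
      blockSum A (fun x => if x = x₀ then (1 : ℝ) else 0) =
        if x₀ ∈ A then Real.log ((j + 1 : ℕ) : ℝ) else 0 := fun A hA => by
    rw [blockSum_indicator, (mem_powersetCard.1 hA).2]
  rw [levelSum, sum_congr rfl h, ← sum_filter, sum_const, card_filter_mem_powersetCard,
    nsmul_eq_mul, levelWeight, Nat.add_sub_cancel]

end Blocks

end Stmt0

open Stmt0 in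
theorem stmt0 {V : Type*} [Fintype V] [DecidableEq V]
    (n : ℕ) (hn : 2 ≤ n) (hcard : Fintype.card V = n)
    (w : ℕ → ℝ) (hw : ∀ ℓ, 0 ≤ w ℓ)
    (α : Finset V → ℝ) (hα : ∀ A : Finset V, α A = if 2 ≤ A.card then w A.card else 0)
    (κ : ℝ)
    (hκ : κ = (∑ ℓ ∈ Finset.Icc 2 n,
        w ℓ * (Nat.choose (n - 1) (ℓ - 1) : ℝ) * Real.log ℓ) / Real.log n) :
    (∀ f : V → ℝ, (∀ x, 0 ≤ f x) → κ * Ent f ≤ Dform α f)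
    ∧ (∀ x₀ : V,
        κ * Ent (fun x => if x = x₀ then (1 : ℝ) else 0)
          = Dform α (fun x => if x = x₀ then (1 : ℝ) else 0))
    ∧ ((∃ ℓ ∈ Finset.Icc 2 (n - 1), 0 < w ℓ) →
        ∀ f : V → ℝ, (∀ x, 0 ≤ f x) → Ent f ≠ 0 →
          κ * Ent f = Dform α f →
          ∃ (x₀ : V) (c : ℝ), 0 < c ∧ f = fun x => if x = x₀ then c else 0) := by
  subst hcard
  have hlogn : 0 < Real.log (Fintype.card V) := Real.log_pos (by exact_mod_cast hn)
  have hcard0 : (0 : ℝ) < 1 / (Fintype.card V : ℝ) := by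
    have : 0 < Fintype.card V := by omega
    positivity
  have hwtop : levelWeight (Fintype.card V) (Fintype.card V) = Real.log (Fintype.card V) := by
    simp [levelWeight]
  set R : ℕ → (V → ℝ) → ℝ := fun ℓ f => levelSum ℓ f / levelWeight (Fintype.card V) ℓ with hR
  have hEnt : ∀ f : V → ℝ, κ * Ent f = (1 / (Fintype.card V : ℝ)) * ∑ ℓ ∈ Icc 2 (Fintype.card V),
      w ℓ * (levelWeight (Fintype.card V) ℓ * R (Fintype.card V) f) := by
    intro f
    simp only [hR, hκ, Ent_eq_blockSum, levelSum_card, hwtop, ← mul_assoc, ← sum_mul]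
    simp only [levelWeight, ← mul_assoc]
    ring
  have hD : ∀ f : V → ℝ, Dform α f = (1 / (Fintype.card V : ℝ)) *
      ∑ ℓ ∈ Icc 2 (Fintype.card V), w ℓ * (levelWeight (Fintype.card V) ℓ * R ℓ f) := by
    intro f
    rw [Dform_eq_sum_levelSum hα]
    congr 1
    refine sum_congr rfl fun ℓ hℓ => ?_
    rw [mem_Icc] at hℓ
    rw [hR, mul_div_cancel₀ _ (levelWeight_pos hℓ.1 hℓ.2).ne']
  have hterm : ∀ f : V → ℝ, (∀ x, 0 ≤ f x) → ∀ ℓ ∈ Icc 2 (Fintype.card V),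
      w ℓ * (levelWeight (Fintype.card V) ℓ * R (Fintype.card V) f) ≤
        w ℓ * (levelWeight (Fintype.card V) ℓ * R ℓ f) := by
    intro f hf ℓ hℓ
    rw [mem_Icc] at hℓ
    exact mul_le_mul_of_nonneg_left (mul_le_mul_of_nonneg_left
      (levelSum_div_antitone hf hℓ.1 hℓ.2 le_rfl) (levelWeight_pos hℓ.1 hℓ.2).le) (hw ℓ)
  refine ⟨fun f hf => ?_, fun x₀ => ?_, fun ⟨ℓ, hℓ, hwℓ⟩ f hf hne heq => ?_⟩
  · rw [hEnt, hD]
    exact mul_le_mul_of_nonneg_left (sum_le_sum (hterm f hf)) hcard0.le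
  · rw [hEnt, hD]
    congr 1
    refine sum_congr rfl fun ℓ hℓ => ?_
    rw [mem_Icc] at hℓ
    simp only [hR]
    rw [levelSum_indicator x₀ (by omega), levelSum_indicator x₀ (by omega),
      div_self (levelWeight_pos hℓ.1 hℓ.2).ne', div_self (levelWeight_pos hn le_rfl).ne']
  · rw [mem_Icc] at hℓ
    rw [hEnt, hD] at heq
    have hℓ' : ℓ ∈ Icc 2 (Fintype.card V) := mem_Icc.2 ⟨hℓ.1, by omega⟩
    have h := (sum_eq_sum_iff_of_le (hterm f hf)).1 (mul_left_cancel₀ hcard0.ne' heq) ℓ hℓ'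
    have hRR := mul_left_cancel₀ (levelWeight_pos hℓ.1 (by omega)).ne' (mul_left_cancel₀ hwℓ.ne' h)
    have hS : blockSum univ f ≠ 0 := fun h0 => hne (by rw [Ent_eq_blockSum, h0, mul_zero])
    obtain ⟨x₀, hx₀⟩ := exists_eq_zero_of_levelSum_div_eq hf hℓ.1 (by omega) hRR.symm hS
    refine ⟨x₀, f x₀, (hf x₀).lt_of_ne fun h0 => hS (blockSum_eq_zero fun x _ => ?_), ?_⟩
    · by_cases hx : x = x₀
      · rw [hx, ← h0]
      · exact hx₀ x hx
    · funext x
      split_ifs with hx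
      · rw [hx]
      · exact hx₀ x hx
end

section
/- For any finite set V with |V| = n ≥ 2, any nonnegative weights α = (α_A)_{A⊆V}, and any N ≥ 1, the entropy constant of the system of N independent particles with synchronous updates satisfies κ[α,N] = κ[α,1]; i.e., the largest κ ≥ 0 such that κ·Ent f ≤ ∑_{A⊆V} α_A ν[Ent_A f] holds for all f : V^N → ℝ≥0 does not depend on N. -/
open Finset

namespace Stmt1

variable {V : Type*} [Fintype V] [DecidableEq V] {N : ℕ}

/-- The set of configurations reachable from `ξ` by a synchronous update of the block `A`:
all coordinates currently in `A` are reassigned arbitrary values in `A`, the others are kept. -/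
def fiber (A : Finset V) (ξ : Fin N → V) : Finset (Fin N → V) :=
  Finset.univ.filter (fun ζ => ∀ i, (ξ i ∈ A → ζ i ∈ A) ∧ (ξ i ∉ A → ζ i = ξ i))

/-- The conditional expectation `ν_A f` of `f` given the occupation variables outside `A`. -/
noncomputable def condExp (A : Finset V) (f : (Fin N → V) → ℝ) (ξ : Fin N → V) : ℝ :=
  (∑ ζ ∈ fiber A ξ, f ζ) / ((fiber A ξ).card : ℝ)

/-- The conditional entropy `Ent_A f = ν_A[f log (f / ν_A f)]`. -/
noncomputable def EntA (A : Finset V) (f : (Fin N → V) → ℝ) (ξ : Fin N → V) : ℝ :=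
  (∑ ζ ∈ fiber A ξ, f ζ * Real.log (f ζ / condExp A f ξ)) / ((fiber A ξ).card : ℝ)

/-- Expectation w.r.t. the uniform distribution `ν` on `V^N`. -/
noncomputable def mean (f : (Fin N → V) → ℝ) : ℝ :=
  (∑ ξ : Fin N → V, f ξ) / ((Fintype.card V : ℝ) ^ N)

/-- The global relative entropy `Ent f = ν[f log (f / ν f)]`. -/
noncomputable def Ent (f : (Fin N → V) → ℝ) : ℝ :=
  mean (fun ξ => f ξ * Real.log (f ξ / mean f))

/-- The set of constants `κ ≥ 0` satisfying the entropy inequality for `N` particles;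
its supremum is the entropy constant `κ[α, N]`. -/
noncomputable def kappaSet (α : Finset V → ℝ) (N : ℕ) : Set ℝ :=
  {κ : ℝ | 0 ≤ κ ∧ ∀ f : (Fin N → V) → ℝ, (∀ ξ, 0 ≤ f ξ) →
    κ * Ent f ≤ ∑ A : Finset V, α A * mean (EntA A f)}

/-- The average of `g` over the finite set `c x` attached to the point `x`. -/
noncomputable def blockAvg {X : Type*} (c : X → Finset X) (g : X → ℝ) (x : X) : ℝ :=
  (∑ y ∈ c x, g y) / ((c x).card : ℝ)

/-- The unnormalized entropy of `g` relative to its block averages. -/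
noncomputable def blockEnt {X : Type*} [Fintype X] (c : X → Finset X) (g : X → ℝ) : ℝ :=
  ∑ x, g x * Real.log (g x / blockAvg c g x)

/-- The sites a single particle at `x` can reach by an update of the block `A`. -/
def block (A : Finset V) (x : V) : Finset V := if x ∈ A then A else {x}

section blockAvg

variable {X : Type*} {c : X → Finset X}

lemma blockAvg_nonneg {g : X → ℝ} (hg : ∀ x, 0 ≤ g x) (x : X) : 0 ≤ blockAvg c g x :=
  div_nonneg (Finset.sum_nonneg fun y _ => hg y) (Nat.cast_nonneg _)

lemma blockAvg_pos (hc : ∀ x, x ∈ c x) {g : X → ℝ} (hg : ∀ x, 0 ≤ g x) {x : X}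
    (hx : 0 < g x) : 0 < blockAvg c g x := by
  have h1 : g x ≤ ∑ y ∈ c x, g y := Finset.single_le_sum (fun y _ => hg y) (hc x)
  have h2 : 0 < (c x).card := Finset.card_pos.2 ⟨x, hc x⟩
  exact div_pos (hx.trans_le h1) (by exact_mod_cast h2)

lemma eq_zero_of_blockAvg_eq_zero (hc : ∀ x, x ∈ c x) {g : X → ℝ} (hg : ∀ x, 0 ≤ g x) {x : X}
    (hx : blockAvg c g x = 0) : g x = 0 := by
  by_contra h
  exact (blockAvg_pos hc hg (lt_of_le_of_ne (hg x) (Ne.symm h))).ne' hx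

lemma sum_blockAvg [Fintype X] (hc : ∀ x, x ∈ c x) (hc' : ∀ x, ∀ y ∈ c x, c y = c x)
    (g : X → ℝ) : ∑ x, blockAvg c g x = ∑ x, g x := by
  classical
  have hsymm : ∀ x y, y ∈ c x ↔ x ∈ c y := fun x y =>
    ⟨fun h => hc' x y h ▸ hc x, fun h => hc' y x h ▸ hc y⟩
  have h1 : ∀ x, blockAvg c g x = ∑ y, if x ∈ c y then g y / ((c y).card : ℝ) else 0 := by
    intro x
    rw [blockAvg, Finset.sum_div, ← Finset.sum_filter]
    refine Finset.sum_congr (by ext y; simp [hsymm x y]) fun y hy => ?_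
    rw [hc' x y ((hsymm x y).2 (Finset.mem_filter.1 hy).2)]
  simp_rw [h1]
  rw [Finset.sum_comm]
  refine Finset.sum_congr rfl fun y _ => ?_
  have h2 : ((c y).card : ℝ) ≠ 0 := by
    exact_mod_cast (Finset.card_pos.2 ⟨y, hc y⟩).ne'
  rw [← Finset.sum_filter]
  simp only [Finset.filter_mem_eq_inter, Finset.univ_inter, Finset.sum_const, nsmul_eq_mul]
  field_simp

lemma sum_mul_blockAvg [Fintype X] (hc : ∀ x, x ∈ c x) (hc' : ∀ x, ∀ y ∈ c x, c y = c x)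
    (g w : X → ℝ) (hw : ∀ x, ∀ y ∈ c x, w y = w x) :
    ∑ x, g x * w x = ∑ x, blockAvg c g x * w x := by
  rw [← sum_blockAvg hc hc' fun x => g x * w x]
  refine Finset.sum_congr rfl fun x _ => ?_
  rw [blockAvg, blockAvg, div_mul_eq_mul_div, Finset.sum_mul]
  congr 1
  exact Finset.sum_congr rfl fun y hy => by rw [hw x y hy]

lemma blockAvg_eq_of_mem (hc' : ∀ x, ∀ y ∈ c x, c y = c x) (g : X → ℝ) {x y : X}
    (hy : y ∈ c x) : blockAvg c g y = blockAvg c g x := by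
  rw [blockAvg, blockAvg, hc' x y hy]

lemma blockAvg_sum {ι : Type*} (s : Finset ι) (h : ι → X → ℝ) (x : X) :
    blockAvg c (fun y => ∑ i ∈ s, h i y) x = ∑ i ∈ s, blockAvg c (h i) x := by
  simp only [blockAvg]
  rw [Finset.sum_comm, Finset.sum_div]

end blockAvg

/-- The log-sum inequality. -/
lemma sum_mul_log_div_sum_le {ι : Type*} (s : Finset ι) (a b : ι → ℝ) (ha : ∀ i, 0 ≤ a i)
    (hb : ∀ i, 0 ≤ b i) (hab : ∀ i, b i = 0 → a i = 0) :
    (∑ i ∈ s, a i) * Real.log ((∑ i ∈ s, a i) / ∑ i ∈ s, b i) ≤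
      ∑ i ∈ s, a i * Real.log (a i / b i) := by
  rcases (Finset.sum_nonneg fun i (_ : i ∈ s) => ha i).eq_or_lt with h0 | hA
  · have h1 : ∀ i ∈ s, a i = 0 := (Finset.sum_eq_zero_iff_of_nonneg fun i _ => ha i).1 h0.symm
    rw [← h0, zero_mul, Finset.sum_eq_zero fun i hi => by rw [h1 i hi, zero_mul]]
  have hB : 0 < ∑ i ∈ s, b i := by
    refine (Finset.sum_nonneg fun i _ => hb i).lt_of_ne' fun h => hA.ne' ?_
    have h1 := (Finset.sum_eq_zero_iff_of_nonneg fun i _ => hb i).1 h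
    exact Finset.sum_eq_zero fun i hi => hab i (h1 i hi)
  set c := (∑ i ∈ s, a i) / ∑ i ∈ s, b i with hc
  have hcpos : 0 < c := div_pos hA hB
  have key : ∀ i ∈ s, a i * Real.log c + (a i - b i * c) ≤ a i * Real.log (a i / b i) := by
    intro i _
    rcases (ha i).eq_or_lt with h | h
    · rw [← h]
      simpa using mul_nonneg (hb i) hcpos.le
    have hbi : 0 < b i := (hb i).lt_of_ne' fun h' => h.ne' (hab i h')
    have h1 := Real.log_le_sub_one_of_pos (div_pos (mul_pos hbi hcpos) h)
    rw [Real.log_div (mul_pos hbi hcpos).ne' h.ne', Real.log_mul hbi.ne' hcpos.ne'] at h1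
    rw [Real.log_div h.ne' hbi.ne']
    have h2 := mul_le_mul_of_nonneg_left h1 h.le
    have h3 : a i * (b i * c / a i - 1) = b i * c - a i := by field_simp
    rw [h3] at h2
    linarith
  have h := Finset.sum_le_sum key
  rw [Finset.sum_add_distrib, Finset.sum_sub_distrib, ← Finset.sum_mul, ← Finset.sum_mul, hc,
    mul_div_cancel₀ _ hB.ne'] at h
  linarith

lemma mem_block_self {W : Type*} [DecidableEq W] (A : Finset W) (x : W) : x ∈ block A x := by
  unfold block
  split_ifs with h <;> simp [h]

lemma mem_fiber_iff {A : Finset V} {ξ ζ : Fin N → V} :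
    ζ ∈ fiber A ξ ↔ ∀ i, ζ i ∈ block A (ξ i) := by
  simp only [fiber, Finset.mem_filter, Finset.mem_univ, true_and]
  refine forall_congr' fun i => ?_
  unfold block
  split_ifs with h <;> simp [h]

lemma block_eq_of_mem {W : Type*} [DecidableEq W] {A : Finset W} {x y : W}
    (h : y ∈ block A x) : block A y = block A x := by
  unfold block at *
  split_ifs at * with h1 h2 <;> simp_all

lemma mem_fiber_self (A : Finset V) (ξ : Fin N → V) : ξ ∈ fiber A ξ :=
  mem_fiber_iff.2 fun i => mem_block_self A (ξ i)

lemma fiber_eq_of_mem {A : Finset V} (ξ : Fin N → V) : ∀ ζ ∈ fiber A ξ,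
    fiber A ζ = fiber A ξ := by
  intro ζ h
  ext χ
  rw [mem_fiber_iff, mem_fiber_iff]
  exact forall_congr' fun i => by rw [block_eq_of_mem (mem_fiber_iff.1 h i)]

lemma cons_mem_fiber {A : Finset V} {x y : V} {ξ ζ : Fin N → V} :
    (Fin.cons y ζ : Fin (N + 1) → V) ∈ fiber A (Fin.cons x ξ : Fin (N + 1) → V) ↔
      y ∈ block A x ∧ ζ ∈ fiber A ξ := by
  simp only [mem_fiber_iff, Fin.forall_fin_succ, Fin.cons_zero, Fin.cons_succ]

lemma sum_fin_cons {W : Type*} [Fintype W] (F : (Fin (N + 1) → W) → ℝ) :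
    ∑ ξ, F ξ = ∑ x, ∑ ζ : Fin N → W, F (Fin.cons x ζ) := by
  rw [← Fintype.sum_prod_type', ← (Fin.consEquiv fun _ => W).sum_comp]
  rfl

lemma sum_fiber_cons (A : Finset V) (x : V) (ξ : Fin N → V) (F : (Fin (N + 1) → V) → ℝ) :
    ∑ χ ∈ fiber A (Fin.cons x ξ : Fin (N + 1) → V), F χ =
      ∑ y ∈ block A x, ∑ ζ ∈ fiber A ξ, F (Fin.cons y ζ) := by
  rw [← Finset.sum_product']
  refine Finset.sum_nbij' (fun χ => (χ 0, Fin.tail χ)) (fun p => Fin.cons p.1 p.2) ?_ ?_ ?_ ?_ ?_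
  · intro χ hχ
    rw [Finset.mem_product]
    rw [← Fin.cons_self_tail χ] at hχ
    exact cons_mem_fiber.1 hχ
  · intro p hp
    exact cons_mem_fiber.2 (Finset.mem_product.1 hp)
  · intro χ _
    exact Fin.cons_self_tail χ
  · intro p _
    simp
  · intro χ _
    rw [Fin.cons_self_tail χ]

lemma blockAvg_fiber_cons (A : Finset V) (x : V) (ξ : Fin N → V) (f : (Fin (N + 1) → V) → ℝ) :
    blockAvg (fiber A) f (Fin.cons x ξ : Fin (N + 1) → V) =
      blockAvg (block A) (fun y => blockAvg (fiber A) (fun ζ => f (Fin.cons y ζ)) ξ) x := by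
  have hcard : ((fiber A (Fin.cons x ξ : Fin (N + 1) → V)).card : ℝ) =
      (block A x).card * (fiber A ξ).card := by
    have := sum_fiber_cons A x ξ fun _ => 1
    simpa using this
  simp only [blockAvg]
  rw [hcard, sum_fiber_cons, ← Finset.sum_div, div_div, mul_comm]

lemma sum_EntA (A : Finset V) (f : (Fin N → V) → ℝ) :
    ∑ ξ, EntA A f ξ = blockEnt (fiber A) f := by
  rw [blockEnt, ← sum_blockAvg (mem_fiber_self A) fiber_eq_of_mem
    fun ξ => f ξ * Real.log (f ξ / blockAvg (fiber A) f ξ)]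
  refine Finset.sum_congr rfl fun ξ _ => ?_
  rw [EntA, blockAvg]
  congr 1
  refine Finset.sum_congr rfl fun ζ hζ => ?_
  rw [blockAvg_eq_of_mem fiber_eq_of_mem f hζ]
  rfl

lemma fiber_univ (ξ : Fin N → V) : fiber Finset.univ ξ = Finset.univ := by
  simp [fiber]

lemma block_univ (x : V) : block Finset.univ x = Finset.univ := by
  simp [block]

lemma Ent_eq (f : (Fin N → V) → ℝ) :
    Ent f = blockEnt (fiber Finset.univ) f / (Fintype.card V : ℝ) ^ N := by
  unfold Ent blockEnt
  rw [mean]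
  congr 1
  refine Finset.sum_congr rfl fun ξ _ => ?_
  simp [blockAvg, fiber_univ, mean]

lemma mem_kappaSet_iff [Nonempty V] {α : Finset V → ℝ} {κ : ℝ} :
    κ ∈ kappaSet α N ↔ 0 ≤ κ ∧ ∀ f : (Fin N → V) → ℝ, (∀ ξ, 0 ≤ f ξ) →
      κ * blockEnt (fiber Finset.univ) f ≤ ∑ A, α A * blockEnt (fiber A) f := by
  have hpos : (0 : ℝ) < (Fintype.card V : ℝ) ^ N := by
    have : 0 < Fintype.card V := Fintype.card_pos
    positivity
  simp only [kappaSet, Set.mem_ofPred_eq, Ent_eq, mean, sum_EntA, ← mul_div_assoc,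
    ← Finset.sum_div, div_le_div_iff_of_pos_right hpos]

/-- Chain rule: conditioning on the first particle splits the entropy, the averages over the other
particles entering through `h`. -/
lemma blockEnt_fiber_cons (A : Finset V) (f : (Fin (N + 1) → V) → ℝ) (hf : ∀ ξ, 0 ≤ f ξ) :
    blockEnt (fiber A) f = ∑ x, blockEnt (fiber A) (fun ζ => f (Fin.cons x ζ)) +
      ∑ x, ∑ ζ : Fin N → V, blockAvg (fiber A) (fun χ => f (Fin.cons x χ)) ζ *
        Real.log (blockAvg (fiber A) (fun χ => f (Fin.cons x χ)) ζ /
          blockAvg (block A) (fun y => blockAvg (fiber A) (fun χ => f (Fin.cons y χ)) ζ) x) := by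
  rw [blockEnt, sum_fin_cons, ← Finset.sum_add_distrib]
  refine Finset.sum_congr rfl fun x _ => ?_
  rw [← sum_mul_blockAvg (mem_fiber_self A) fiber_eq_of_mem (fun ζ => f (Fin.cons x ζ))
    (fun ζ => Real.log (blockAvg (fiber A) (fun χ => f (Fin.cons x χ)) ζ /
      blockAvg (block A) (fun y => blockAvg (fiber A) (fun χ => f (Fin.cons y χ)) ζ) x)),
    blockEnt, ← Finset.sum_add_distrib]
  · refine Finset.sum_congr rfl fun ζ _ => ?_
    rw [blockAvg_fiber_cons]
    rcases (hf (Fin.cons x ζ)).eq_or_lt with h | h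
    · simp [← h]
    have h1 : 0 < blockAvg (fiber A) (fun χ => f (Fin.cons x χ)) ζ :=
      blockAvg_pos (mem_fiber_self A) (fun χ => hf _) h
    have h2 : 0 < blockAvg (block A)
        (fun y => blockAvg (fiber A) (fun χ => f (Fin.cons y χ)) ζ) x :=
      blockAvg_pos (mem_block_self A) (fun y => blockAvg_nonneg (fun χ => hf _) ζ) h1
    rw [Real.log_div h.ne' h2.ne', Real.log_div h.ne' h1.ne', Real.log_div h1.ne' h2.ne']
    ring
  · intro ζ χ hχ
    simp only [blockAvg_eq_of_mem fiber_eq_of_mem _ hχ]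

lemma sum_blockEnt_add_le (A : Finset V) (f : (Fin (N + 1) → V) → ℝ) (hf : ∀ ξ, 0 ≤ f ξ) :
    ∑ x, blockEnt (fiber A) (fun ζ => f (Fin.cons x ζ)) +
      blockEnt (block A) (fun x => ∑ ζ : Fin N → V, f (Fin.cons x ζ)) ≤
      blockEnt (fiber A) f := by
  rw [blockEnt_fiber_cons A f hf]
  gcongr
  rw [blockEnt]
  refine Finset.sum_le_sum fun x _ => ?_
  have hsum : (fun y => ∑ ζ : Fin N → V, f (Fin.cons y ζ)) =
      fun y => ∑ ζ, blockAvg (fiber A) (fun χ : Fin N → V => f (Fin.cons y χ)) ζ :=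
    funext fun y => (sum_blockAvg (mem_fiber_self A) fiber_eq_of_mem _).symm
  rw [hsum, blockAvg_sum, ← sum_blockAvg (mem_fiber_self A) fiber_eq_of_mem]
  refine sum_mul_log_div_sum_le _ _ _ (fun ζ => blockAvg_nonneg (fun χ => hf _) ζ)
    (fun ζ => blockAvg_nonneg (fun y => blockAvg_nonneg (fun χ => hf _) ζ) x) fun ζ h => ?_
  exact eq_zero_of_blockAvg_eq_zero (mem_block_self A)
    (fun y => blockAvg_nonneg (fun χ => hf (Fin.cons y χ)) ζ) h

lemma blockEnt_univ_cons [Nonempty V] (f : (Fin (N + 1) → V) → ℝ) (hf : ∀ ξ, 0 ≤ f ξ) :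
    blockEnt (fiber Finset.univ) f =
      ∑ x, blockEnt (fiber Finset.univ) (fun ζ => f (Fin.cons x ζ)) +
      blockEnt (block Finset.univ) (fun x => ∑ ζ : Fin N → V, f (Fin.cons x ζ)) := by
  rw [blockEnt_fiber_cons _ f hf]
  congr 1
  rw [blockEnt]
  refine Finset.sum_congr rfl fun x _ => ?_
  have hM : (Fintype.card (Fin N → V) : ℝ) ≠ 0 := by
    exact_mod_cast Fintype.card_ne_zero
  simp only [blockAvg, fiber_univ, block_univ, Finset.card_univ, Finset.sum_const, nsmul_eq_mul,
    ← Finset.sum_div]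
  rw [← mul_assoc, mul_div_cancel₀ _ hM]
  congr 2
  field_simp

lemma blockEnt_comp_zero (A : Finset V) (g : V → ℝ) :
    blockEnt (fiber A) (fun ξ : Fin (N + 1) → V => g (ξ 0)) =
      (Fintype.card V : ℝ) ^ N * blockEnt (block A) g := by
  have h : ∀ (y : V) (ζ : Fin N → V), blockAvg (fiber A) (fun _ : Fin N → V => g y) ζ = g y := by
    intro y ζ
    have : ((fiber A ζ).card : ℝ) ≠ 0 := by
      exact_mod_cast (Finset.card_pos.2 ⟨ζ, mem_fiber_self A ζ⟩).ne'
    rw [blockAvg, Finset.sum_const, nsmul_eq_mul]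
    field_simp
  rw [blockEnt, sum_fin_cons, blockEnt, Finset.mul_sum]
  refine Finset.sum_congr rfl fun x _ => ?_
  simp only [blockAvg_fiber_cons, Fin.cons_zero, h, Finset.sum_const, Finset.card_univ,
    Fintype.card_fun, Fintype.card_fin, nsmul_eq_mul, Nat.cast_pow]

lemma blockEnt_fin_zero (A : Finset V) (f : (Fin 0 → V) → ℝ) : blockEnt (fiber A) f = 0 := by
  refine Finset.sum_eq_zero fun ξ _ => ?_
  have h : fiber A ξ = {ξ} := by
    ext ζ
    simp [mem_fiber_iff, Subsingleton.elim ζ ξ]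
  rw [blockAvg, h]
  by_cases h0 : f ξ = 0 <;> simp [h0]

lemma mem_kappaSet_of_single [Nonempty V] {α : Finset V → ℝ} (hα : ∀ A, 0 ≤ α A) {κ : ℝ}
    (hκ : 0 ≤ κ) (h : ∀ g : V → ℝ, (∀ x, 0 ≤ g x) →
      κ * blockEnt (block Finset.univ) g ≤ ∑ A, α A * blockEnt (block A) g) (N : ℕ) :
    κ ∈ kappaSet α N := by
  induction N with
  | zero => exact mem_kappaSet_iff.2 ⟨hκ, fun f _ => by simp [blockEnt_fin_zero]⟩
  | succ N ih =>
    refine mem_kappaSet_iff.2 ⟨hκ, fun f hf => ?_⟩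
    have ih' := (mem_kappaSet_iff.1 ih).2
    calc κ * blockEnt (fiber Finset.univ) f
        = ∑ x, κ * blockEnt (fiber Finset.univ) (fun ζ => f (Fin.cons x ζ)) +
          κ * blockEnt (block Finset.univ) (fun x => ∑ ζ : Fin N → V, f (Fin.cons x ζ)) := by
          rw [blockEnt_univ_cons f hf, mul_add, Finset.mul_sum]
      _ ≤ ∑ x, ∑ A, α A * blockEnt (fiber A) (fun ζ => f (Fin.cons x ζ)) +
          ∑ A, α A * blockEnt (block A) (fun x => ∑ ζ : Fin N → V, f (Fin.cons x ζ)) :=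
          add_le_add (Finset.sum_le_sum fun x _ => ih' _ fun ζ => hf _)
            (h _ fun x => Finset.sum_nonneg fun ζ _ => hf _)
      _ = ∑ A, α A * (∑ x, blockEnt (fiber A) (fun ζ => f (Fin.cons x ζ)) +
          blockEnt (block A) (fun x => ∑ ζ : Fin N → V, f (Fin.cons x ζ))) := by
          rw [Finset.sum_comm, ← Finset.sum_add_distrib]
          exact Finset.sum_congr rfl fun A _ => by rw [mul_add, Finset.mul_sum]
      _ ≤ ∑ A, α A * blockEnt (fiber A) f :=
          Finset.sum_le_sum fun A _ =>
            mul_le_mul_of_nonneg_left (sum_blockEnt_add_le A f hf) (hα A)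

lemma single_of_mem_kappaSet [Nonempty V] {α : Finset V → ℝ} {κ : ℝ}
    (h : κ ∈ kappaSet α (N + 1)) (g : V → ℝ) (hg : ∀ x, 0 ≤ g x) :
    κ * blockEnt (block Finset.univ) g ≤ ∑ A, α A * blockEnt (block A) g := by
  have hpos : (0 : ℝ) < (Fintype.card V : ℝ) ^ N := by
    have : 0 < Fintype.card V := Fintype.card_pos
    positivity
  have h1 := (mem_kappaSet_iff.1 h).2 (fun ξ => g (ξ 0)) fun ξ => hg _
  simp only [blockEnt_comp_zero, mul_left_comm _ ((Fintype.card V : ℝ) ^ N),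
    ← Finset.mul_sum] at h1
  exact le_of_mul_le_mul_left h1 hpos

end Stmt1

open Stmt1 in
theorem stmt1 {V : Type*} [Fintype V] [DecidableEq V]
    (hn : 2 ≤ Fintype.card V)
    (α : Finset V → ℝ) (hα : ∀ A, 0 ≤ α A)
    (N : ℕ) (hN : 1 ≤ N) :
    sSup (kappaSet (V := V) α N) = sSup (kappaSet (V := V) α 1) := by
  have : Nonempty V := Fintype.card_pos_iff.1 (by omega)
  obtain ⟨M, rfl⟩ := Nat.exists_eq_add_of_le' hN
  congr 1
  ext κ
  constructor <;> intro h <;>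
    exact mem_kappaSet_of_single hα h.1 (single_of_mem_kappaSet h) _
end

section
/- For any finite set V with |V| = n ≥ 2, any nonnegative weights α = (α_A)_{A⊆V}, and any N ≥ 1, the spectral gap of the system of N independent particles with synchronous updates satisfies λ[α,N] = λ[α,1]; i.e., the largest λ ≥ 0 such that λ·Var f ≤ ∑_{A⊆V} α_A ν[Var_A f] holds for all f : V^N → ℝ does not depend on N. -/
open Finset

namespace Stmt2

variable {V : Type*} [Fintype V] [DecidableEq V] {N : ℕ}

/-- The set of configurations reachable from `ξ` by a synchronous update of the block `A`:
all coordinates currently in `A` are reassigned arbitrary values in `A`, the others are kept. -/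
def fiber (A : Finset V) (ξ : Fin N → V) : Finset (Fin N → V) :=
  Finset.univ.filter (fun ζ => ∀ i, (ξ i ∈ A → ζ i ∈ A) ∧ (ξ i ∉ A → ζ i = ξ i))

/-- The conditional expectation `ν_A f` of `f` given the occupation variables outside `A`. -/
noncomputable def condExp (A : Finset V) (f : (Fin N → V) → ℝ) (ξ : Fin N → V) : ℝ :=
  (∑ ζ ∈ fiber A ξ, f ζ) / ((fiber A ξ).card : ℝ)

/-- The conditional variance `Var_A f = ν_A[(f - ν_A f)²]`. -/
noncomputable def VarA (A : Finset V) (f : (Fin N → V) → ℝ) (ξ : Fin N → V) : ℝ :=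
  (∑ ζ ∈ fiber A ξ, (f ζ - condExp A f ξ) ^ 2) / ((fiber A ξ).card : ℝ)

/-- Expectation w.r.t. the uniform distribution `ν` on `V^N`. -/
noncomputable def mean (f : (Fin N → V) → ℝ) : ℝ :=
  (∑ ξ : Fin N → V, f ξ) / ((Fintype.card V : ℝ) ^ N)

/-- The global variance `Var f = ν(f²) - ν(f)²`. -/
noncomputable def Var (f : (Fin N → V) → ℝ) : ℝ :=
  mean (fun ξ => f ξ ^ 2) - (mean f) ^ 2

/-- The set of constants `λ ≥ 0` satisfying the Poincaré inequality for `N` particles;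
its supremum is the spectral gap `λ[α, N]`. -/
noncomputable def gapSet (α : Finset V → ℝ) (N : ℕ) : Set ℝ :=
  {l : ℝ | 0 ≤ l ∧ ∀ f : (Fin N → V) → ℝ,
    l * Var f ≤ ∑ A : Finset V, α A * mean (VarA A f)}

end Stmt2

namespace Stmt2

/-- Averaging over the classes of a partition preserves sums. -/
theorem sum_average_class {ι : Type*} [Fintype ι] [DecidableEq ι] (s : ι → Finset ι)
    (hself : ∀ x, x ∈ s x) (hs : ∀ x y, y ∈ s x → s y = s x) (g : ι → ℝ) :
    ∑ x, (∑ y ∈ s x, g y) / ((s x).card : ℝ) = ∑ x, g x := by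
  have hsymm : ∀ x y, y ∈ s x ↔ x ∈ s y := fun x y =>
    ⟨fun h => by rw [hs x y h]; exact hself x, fun h => by rw [hs y x h]; exact hself y⟩
  have hterm : ∀ x, (∑ y ∈ s x, g y) / ((s x).card : ℝ)
      = ∑ y, if x ∈ s y then g y / ((s y).card : ℝ) else 0 := by
    intro x
    rw [Finset.sum_div, ← Finset.sum_filter]
    have : Finset.univ.filter (fun y => x ∈ s y) = s x := by
      ext y; simp [hsymm x y]
    rw [this]
    exact Finset.sum_congr rfl fun y hy => by rw [hs x y hy]
  simp_rw [hterm]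
  rw [Finset.sum_comm]
  refine Finset.sum_congr rfl fun y _ => ?_
  rw [← Finset.sum_filter, Finset.filter_univ_mem, Finset.sum_const, nsmul_eq_mul]
  have : ((s y).card : ℝ) ≠ 0 := by
    exact_mod_cast (Finset.card_pos.2 ⟨y, hself y⟩).ne'
  field_simp

variable {V : Type*} [DecidableEq V]

/-- The sites reachable by a single particle at `x` when the block `A` is updated. -/
def cell (A : Finset V) (x : V) : Finset V := if x ∈ A then A else {x}

/-- The one-particle conditional expectation. -/
noncomputable def cellAvg (A : Finset V) (g : V → ℝ) (x : V) : ℝ :=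
  (∑ y ∈ cell A x, g y) / ((cell A x).card : ℝ)

theorem mem_cell {A : Finset V} {x y : V} :
    y ∈ cell A x ↔ (x ∈ A → y ∈ A) ∧ (x ∉ A → y = x) := by
  unfold cell; split_ifs with h <;> simp [h]

theorem self_mem_cell (A : Finset V) (x : V) : x ∈ cell A x := by
  simp [mem_cell]

theorem cell_eq_of_mem {A : Finset V} {x y : V} (h : y ∈ cell A x) : cell A y = cell A x := by
  rw [mem_cell] at h
  by_cases hx : x ∈ A
  · simp [cell, hx, h.1 hx]
  · rw [h.2 hx]

theorem card_cell_ne_zero (A : Finset V) (x : V) : ((cell A x).card : ℝ) ≠ 0 := by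
  exact_mod_cast (Finset.card_pos.2 ⟨x, self_mem_cell A x⟩).ne'

theorem cellAvg_const_add (A : Finset V) (c : ℝ) (g : V → ℝ) (x : V) :
    cellAvg A (fun y => c + g y) x = c + cellAvg A g x := by
  have := card_cell_ne_zero A x
  simp only [cellAvg, Finset.sum_add_distrib, Finset.sum_const, nsmul_eq_mul]
  field_simp

variable [Fintype V] {N : ℕ}

theorem mem_fiber {A : Finset V} {ξ ζ : Fin N → V} :
    ζ ∈ fiber A ξ ↔ ∀ i, ζ i ∈ cell A (ξ i) := by
  simp [fiber, mem_cell]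

theorem self_mem_fiber (A : Finset V) (ξ : Fin N → V) : ξ ∈ fiber A ξ :=
  mem_fiber.2 fun i => self_mem_cell A (ξ i)

theorem fiber_eq_of_mem {A : Finset V} {ξ ζ : Fin N → V} (h : ζ ∈ fiber A ξ) :
    fiber A ζ = fiber A ξ := by
  ext χ
  simp only [mem_fiber]
  exact forall_congr' fun i => by rw [cell_eq_of_mem (mem_fiber.1 h i)]

theorem card_fiber_ne_zero (A : Finset V) (ξ : Fin N → V) : ((fiber A ξ).card : ℝ) ≠ 0 := by
  exact_mod_cast (Finset.card_pos.2 ⟨ξ, self_mem_fiber A ξ⟩).ne'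

theorem sum_cellAvg (A : Finset V) (g : V → ℝ) : ∑ x, cellAvg A g x = ∑ x, g x :=
  sum_average_class (cell A) (self_mem_cell A) (fun _ _ => cell_eq_of_mem) g

theorem sum_condExp (A : Finset V) (f : (Fin N → V) → ℝ) : ∑ ξ, condExp A f ξ = ∑ ξ, f ξ :=
  sum_average_class (fiber A) (self_mem_fiber A) (fun _ _ => fiber_eq_of_mem) f

theorem VarA_eq (A : Finset V) (f : (Fin N → V) → ℝ) (ξ : Fin N → V) :
    VarA A f ξ = condExp A (fun ζ => f ζ ^ 2) ξ - condExp A f ξ ^ 2 := by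
  have hc := card_fiber_ne_zero A ξ
  have hm : ∑ ζ ∈ fiber A ξ, f ζ = condExp A f ξ * (fiber A ξ).card := by
    unfold condExp; field_simp
  have : ∑ ζ ∈ fiber A ξ, (f ζ - condExp A f ξ) ^ 2
      = ∑ ζ ∈ fiber A ξ, f ζ ^ 2 - (fiber A ξ).card * condExp A f ξ ^ 2 := by
    simp only [sub_sq, Finset.sum_add_distrib, Finset.sum_sub_distrib, Finset.sum_const,
      nsmul_eq_mul, ← Finset.sum_mul, ← Finset.mul_sum, hm]
    ring
  rw [VarA, this, sub_div, mul_div_cancel_left₀ _ hc]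
  rfl

theorem sum_VarA (A : Finset V) (f : (Fin N → V) → ℝ) :
    ∑ ξ, VarA A f ξ = ∑ ξ, f ξ ^ 2 - ∑ ξ, condExp A f ξ ^ 2 := by
  simp only [VarA_eq, Finset.sum_sub_distrib, sum_condExp]

theorem VarA_nonneg (A : Finset V) (f : (Fin N → V) → ℝ) (ξ : Fin N → V) : 0 ≤ VarA A f ξ :=
  div_nonneg (Finset.sum_nonneg fun _ _ => sq_nonneg _) (Nat.cast_nonneg _)

theorem sum_sq_condExp_le (A : Finset V) (f : (Fin N → V) → ℝ) :
    ∑ ξ, condExp A f ξ ^ 2 ≤ ∑ ξ, f ξ ^ 2 := by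
  have h := sum_VarA A f
  have : 0 ≤ ∑ ξ, VarA A f ξ := Finset.sum_nonneg fun ξ _ => VarA_nonneg A f ξ
  linarith

theorem condExp_add (A : Finset V) (f g : (Fin N → V) → ℝ) (ξ : Fin N → V) :
    condExp A (fun ζ => f ζ + g ζ) ξ = condExp A f ξ + condExp A g ξ := by
  simp only [condExp, Finset.sum_add_distrib, add_div]

theorem condExp_sum {ι : Type*} (s : Finset ι) (A : Finset V) (f : ι → (Fin N → V) → ℝ)
    (ξ : Fin N → V) :
    condExp A (fun ζ => ∑ i ∈ s, f i ζ) ξ = ∑ i ∈ s, condExp A (f i) ξ := by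
  simp only [condExp, ← Finset.sum_div]
  rw [Finset.sum_comm]

theorem condExp_const (A : Finset V) (c : ℝ) (ξ : Fin N → V) :
    condExp A (fun _ => c) ξ = c := by
  simp only [condExp, Finset.sum_const, nsmul_eq_mul]
  exact mul_div_cancel_left₀ c (card_fiber_ne_zero A ξ)

theorem sum_cons {ι M : Type*} [Fintype ι] [AddCommMonoid M] (f : (Fin (N + 1) → ι) → M) :
    ∑ ξ, f ξ = ∑ x : ι, ∑ ζ : Fin N → ι, f (Fin.cons x ζ) := by
  rw [← (Fin.consEquiv fun _ => ι).sum_comp f, Fintype.sum_prod_type]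
  rfl

theorem sum_fiber_cons {M : Type*} [AddCommMonoid M] (A : Finset V)
    (f : (Fin (N + 1) → V) → M) (x : V) (ξ : Fin N → V) :
    ∑ χ ∈ fiber A (Fin.cons x ξ : Fin (N + 1) → V), f χ
      = ∑ y ∈ cell A x, ∑ ζ ∈ fiber A ξ, f (Fin.cons y ζ) := by
  have h (y : V) (ζ : Fin N → V) :
      (Fin.cons y ζ : Fin (N + 1) → V) ∈ fiber A (Fin.cons x ξ : Fin (N + 1) → V)
        ↔ y ∈ cell A x ∧ ζ ∈ fiber A ξ := by
    simp [mem_fiber, Fin.forall_fin_succ]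
  rw [← Finset.filter_univ_mem (fiber A (Fin.cons x ξ : Fin (N + 1) → V)), Finset.sum_filter,
    sum_cons, ← Finset.filter_univ_mem (cell A x), Finset.sum_filter]
  refine Finset.sum_congr rfl fun y _ => ?_
  by_cases hy : y ∈ cell A x
  · simp only [h, hy, true_and, if_true]
    rw [← Finset.sum_filter, Finset.filter_univ_mem]
  · simp [h, hy]

theorem condExp_cons (A : Finset V) (f : (Fin (N + 1) → V) → ℝ) (x : V) (ξ : Fin N → V) :
    condExp A f (Fin.cons x ξ)
      = condExp A (fun ζ => cellAvg A (fun y => f (Fin.cons y ζ)) x) ξ := by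
  have hcard : (fiber A (Fin.cons x ξ : Fin (N + 1) → V)).card
      = (cell A x).card * (fiber A ξ).card := by
    have := sum_fiber_cons A (fun _ => 1) x ξ
    simpa using this
  simp only [condExp, cellAvg, hcard, sum_fiber_cons, ← Finset.sum_div, Nat.cast_mul, div_div]
  rw [Finset.sum_comm]

/-- The one-particle Poincaré inequality, in terms of unnormalized sums on `V`. -/
def SitePoincare (α : Finset V → ℝ) (l : ℝ) : Prop :=
  ∀ g : V → ℝ, l * (∑ x, g x ^ 2 - (∑ x, g x) ^ 2 / (Fintype.card V : ℝ))
    ≤ ∑ A : Finset V, α A * (∑ x, g x ^ 2 - ∑ x, cellAvg A g x ^ 2)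

/-- The `N`-particle Poincaré inequality, in terms of unnormalized sums on `V ^ N`. -/
def ConfigPoincare (α : Finset V → ℝ) (l : ℝ) (N : ℕ) : Prop :=
  ∀ f : (Fin N → V) → ℝ, l * (∑ ξ, f ξ ^ 2 - (∑ ξ, f ξ) ^ 2 / (Fintype.card V : ℝ) ^ N)
    ≤ ∑ A : Finset V, α A * (∑ ξ, f ξ ^ 2 - ∑ ξ, condExp A f ξ ^ 2)

theorem mem_gapSet_iff (hV : 0 < Fintype.card V) (α : Finset V → ℝ) (l : ℝ) :
    l ∈ gapSet α N ↔ 0 ≤ l ∧ ConfigPoincare α l N := by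
  have hpos : (0 : ℝ) < (Fintype.card V : ℝ) ^ N := by positivity
  refine and_congr_right fun _ => forall_congr' fun f => ?_
  have hL : l * Var f = l * (∑ ξ, f ξ ^ 2 - (∑ ξ, f ξ) ^ 2 / (Fintype.card V : ℝ) ^ N)
      / (Fintype.card V : ℝ) ^ N := by
    unfold Var mean; field_simp
  have hR : ∑ A : Finset V, α A * mean (VarA A f)
      = (∑ A : Finset V, α A * (∑ ξ, f ξ ^ 2 - ∑ ξ, condExp A f ξ ^ 2))
        / (Fintype.card V : ℝ) ^ N := by
    simp only [mean, sum_VarA, Finset.sum_div, mul_div_assoc]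
  rw [hL, hR, div_le_div_iff_of_pos_right hpos]

/-- Functions of the first particle alone reduce the `N + 1` particle inequality to one particle. -/
theorem ConfigPoincare.sitePoincare (hV : 0 < Fintype.card V) {α : Finset V → ℝ} {l : ℝ}
    (h : ConfigPoincare α l (N + 1)) : SitePoincare α l := by
  intro g
  have hpos : (0 : ℝ) < (Fintype.card V : ℝ) ^ N := by positivity
  have hn : (Fintype.card V : ℝ) ≠ 0 := by positivity
  have key := h fun ξ => g (ξ 0)
  simp only [sum_cons, condExp_cons, condExp_const, Fin.cons_zero, Finset.sum_const,
    Finset.card_univ, Fintype.card_fun, Fintype.card_fin, nsmul_eq_mul, Nat.cast_pow,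
    ← Finset.mul_sum, ← mul_sub] at key
  refine le_of_mul_le_mul_left (le_trans (le_of_eq ?_) (key.trans (le_of_eq ?_))) hpos
  · simp only [pow_succ]
    field_simp
  · rw [Finset.mul_sum]
    exact Finset.sum_congr rfl fun A _ => by ring

theorem sum_sq_add_of_sum_eq_zero {ι : Type*} [Fintype ι] (c : ℝ) (g : ι → ℝ)
    (hg : ∑ x, g x = 0) : ∑ x, (c + g x) ^ 2 = Fintype.card ι * c ^ 2 + ∑ x, g x ^ 2 := by
  simp [add_sq, Finset.sum_add_distrib, ← Finset.mul_sum, hg]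

/-- Splitting the first particle off: the average over its position satisfies the `N` particle
inequality, and the fluctuations around the average satisfy the one-particle inequality. -/
theorem ConfigPoincare.succ (hV : 0 < Fintype.card V) {α : Finset V → ℝ} (hα : ∀ A, 0 ≤ α A)
    {l : ℝ} (h₁ : SitePoincare α l) (h : ConfigPoincare α l N) : ConfigPoincare α l (N + 1) := by
  intro f
  have hn : (Fintype.card V : ℝ) ≠ 0 := by positivity
  set n : ℝ := (Fintype.card V : ℝ) with hn_def
  obtain ⟨m, hm⟩ : ∃ m : (Fin N → V) → ℝ, ∀ ζ, m ζ = (∑ x, f (Fin.cons x ζ)) / n :=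
    ⟨_, fun _ => rfl⟩
  obtain ⟨G, hG⟩ : ∃ G : V → (Fin N → V) → ℝ, ∀ x ζ, f (Fin.cons x ζ) = m ζ + G x ζ :=
    ⟨fun x ζ => f (Fin.cons x ζ) - m ζ, fun x ζ => by ring⟩
  have hG0 (ζ) : ∑ x, G x ζ = 0 := by
    have h0 := hm ζ
    simp only [hG, Finset.sum_add_distrib, Finset.sum_const, Finset.card_univ, nsmul_eq_mul,
      ← hn_def] at h0
    field_simp at h0
    linarith
  have hsum : ∑ ξ, f ξ = n * ∑ ζ, m ζ := by
    rw [sum_cons, Finset.sum_comm, Finset.mul_sum]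
    refine Finset.sum_congr rfl fun ζ _ => ?_
    rw [hm]; field_simp
  have hsq : ∑ ξ, f ξ ^ 2 = n * ∑ ζ, m ζ ^ 2 + ∑ ζ, ∑ x, G x ζ ^ 2 := by
    rw [sum_cons, Finset.sum_comm, Finset.mul_sum, ← Finset.sum_add_distrib]
    refine Finset.sum_congr rfl fun ζ _ => ?_
    simp only [hG]
    exact sum_sq_add_of_sum_eq_zero _ _ (hG0 ζ)
  have hcond (A : Finset V) : ∑ ξ, condExp A f ξ ^ 2
      ≤ n * ∑ ζ, condExp A m ζ ^ 2 + ∑ ζ, ∑ x, cellAvg A (fun y => G y ζ) x ^ 2 := by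
    have hH0 (ζ) : ∑ x, condExp A (fun χ => cellAvg A (fun y => G y χ) x) ζ = 0 := by
      rw [← condExp_sum]
      simp only [sum_cellAvg, hG0, condExp_const]
    have heq : ∑ ξ, condExp A f ξ ^ 2 = n * ∑ ζ, condExp A m ζ ^ 2
        + ∑ x, ∑ ζ, condExp A (fun χ => cellAvg A (fun y => G y χ) x) ζ ^ 2 := by
      rw [sum_cons, Finset.sum_comm, Finset.mul_sum,
        Finset.sum_comm (γ := V), ← Finset.sum_add_distrib]
      refine Finset.sum_congr rfl fun ζ _ => ?_
      simp only [condExp_cons, hG, cellAvg_const_add, condExp_add]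
      exact sum_sq_add_of_sum_eq_zero _ _ (hH0 ζ)
    rw [heq, Finset.sum_comm (s := Finset.univ (α := Fin N → V))]
    exact add_le_add_right (Finset.sum_le_sum fun x _ => sum_sq_condExp_le A _) _
  have hfluct : l * ∑ ζ, ∑ x, G x ζ ^ 2 ≤ ∑ A : Finset V, α A *
      (∑ ζ, ∑ x, G x ζ ^ 2 - ∑ ζ, ∑ x, cellAvg A (fun y => G y ζ) x ^ 2) := by
    simp only [← Finset.sum_sub_distrib, Finset.mul_sum (ι := Fin N → V)]
    rw [Finset.sum_comm]
    refine Finset.sum_le_sum fun ζ _ => ?_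
    simpa [hG0 ζ] using h₁ fun x => G x ζ
  have hmean := mul_le_mul_of_nonneg_left (h m) (Nat.cast_nonneg (Fintype.card V) : (0 : ℝ) ≤ _)
  rw [← hn_def] at hmean
  calc l * (∑ ξ, f ξ ^ 2 - (∑ ξ, f ξ) ^ 2 / n ^ (N + 1))
      = n * (l * (∑ ζ, m ζ ^ 2 - (∑ ζ, m ζ) ^ 2 / n ^ N)) + l * ∑ ζ, ∑ x, G x ζ ^ 2 := by
        rw [hsum, hsq, pow_succ]; field_simp; ring
    _ ≤ _ := add_le_add hmean hfluct
    _ = ∑ A : Finset V, α A * ((n * ∑ ζ, m ζ ^ 2 + ∑ ζ, ∑ x, G x ζ ^ 2)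
          - (n * ∑ ζ, condExp A m ζ ^ 2 + ∑ ζ, ∑ x, cellAvg A (fun y => G y ζ) x ^ 2)) := by
        rw [Finset.mul_sum, ← Finset.sum_add_distrib]
        exact Finset.sum_congr rfl fun A _ => by ring
    _ ≤ ∑ A : Finset V, α A * (∑ ξ, f ξ ^ 2 - ∑ ξ, condExp A f ξ ^ 2) := by
        rw [← hsq]
        exact Finset.sum_le_sum fun A _ =>
          mul_le_mul_of_nonneg_left (sub_le_sub_left (hcond A) _) (hα A)

theorem SitePoincare.configPoincare (hV : 0 < Fintype.card V) {α : Finset V → ℝ}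
    (hα : ∀ A, 0 ≤ α A) {l : ℝ} (h₁ : SitePoincare α l) (N : ℕ) : ConfigPoincare α l N := by
  induction N with
  | zero =>
    intro f
    have hR : 0 ≤ ∑ A : Finset V, α A * (∑ ξ, f ξ ^ 2 - ∑ ξ, condExp A f ξ ^ 2) :=
      Finset.sum_nonneg fun A _ =>
        mul_nonneg (hα A) (sub_nonneg.2 (sum_sq_condExp_le A f))
    simpa using hR
  | succ N ih => exact ih.succ hV hα h₁

theorem mem_gapSet_iff_sitePoincare (hV : 0 < Fintype.card V) {α : Finset V → ℝ}
    (hα : ∀ A, 0 ≤ α A) (hN : 1 ≤ N) (l : ℝ) :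
    l ∈ gapSet α N ↔ 0 ≤ l ∧ SitePoincare α l := by
  obtain ⟨N, rfl⟩ := Nat.exists_eq_succ_of_ne_zero (Nat.one_le_iff_ne_zero.1 hN)
  rw [mem_gapSet_iff hV]
  exact and_congr_right fun _ =>
    ⟨fun h => h.sitePoincare hV, fun h => h.configPoincare hV hα _⟩

end Stmt2

open Stmt2 in
theorem stmt2 {V : Type*} [Fintype V] [DecidableEq V]
    (hn : 2 ≤ Fintype.card V)
    (α : Finset V → ℝ) (hα : ∀ A, 0 ≤ α A)
    (N : ℕ) (hN : 1 ≤ N) :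
    sSup (gapSet (V := V) α N) = sSup (gapSet (V := V) α 1) := by
  have hV : 0 < Fintype.card V := by lia
  congr 1
  ext l
  rw [mem_gapSet_iff_sitePoincare hV hα hN, mem_gapSet_iff_sitePoincare hV hα le_rfl]
end

section
/- Let n ≥ 2, let w_2,…,w_n ≥ 0 and define weights α by α_A = w_{|A|} for |A| ≥ 2 (α_A = 0 otherwise). Then the entropy constant of the α-shuffle process on the symmetric group satisfies κ[α,S_n] = ∑_{ℓ=2}^n w_ℓ · C(n,ℓ) · log(ℓ!) / log(n!). Precisely: (i) for every f : S_n → ℝ≥0, (∑_ℓ w_ℓ C(n,ℓ) log(ℓ!)/log(n!)) · Ent f ≤ ∑_{A⊆V} α_A μ[Ent_A f]; (ii) for every permutation σ₀, the indicator f = 1_{σ₀} achieves equality; and (iii) if w_ℓ > 0 for some ℓ ≤ n−1, any f with Ent f ≠ 0 achieving equality is a positive multiple of the indicator of a single permutation. -/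
open Finset

namespace Stmt4

variable {V : Type*} [Fintype V] [DecidableEq V]

/-- The permutations agreeing with `σ` outside the block `A`. -/
def permFiber (A : Finset V) (σ : Equiv.Perm V) : Finset (Equiv.Perm V) :=
  Finset.univ.filter (fun τ => ∀ z ∉ A, τ z = σ z)

/-- The conditional expectation `μ_A f` given the labels outside `A`. -/
noncomputable def condExp (A : Finset V) (f : Equiv.Perm V → ℝ) (σ : Equiv.Perm V) : ℝ :=
  (∑ τ ∈ permFiber A σ, f τ) / ((permFiber A σ).card : ℝ)

/-- The conditional entropy `Ent_A f = μ_A[f log (f / μ_A f)]`. -/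
noncomputable def EntA (A : Finset V) (f : Equiv.Perm V → ℝ) (σ : Equiv.Perm V) : ℝ :=
  (∑ τ ∈ permFiber A σ, f τ * Real.log (f τ / condExp A f σ)) / ((permFiber A σ).card : ℝ)

/-- Expectation w.r.t. the uniform distribution `μ` on the symmetric group. -/
noncomputable def mean (f : Equiv.Perm V → ℝ) : ℝ :=
  (∑ σ : Equiv.Perm V, f σ) / (Fintype.card (Equiv.Perm V) : ℝ)

/-- The global entropy `Ent f = μ[f log (f / μ f)]`. -/
noncomputable def Ent (f : Equiv.Perm V → ℝ) : ℝ :=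
  mean (fun σ => f σ * Real.log (f σ / mean f))

end Stmt4

namespace Stmt4

section Analytic

open Real Set

lemma deriv_deriv_eq_of_hasDerivAt {f f' : ℝ → ℝ} {s : Set ℝ} {x v : ℝ} (hs : IsOpen s)
    (hx : x ∈ s) (h1 : ∀ y ∈ s, HasDerivAt f (f' y) y) (h2 : HasDerivAt f' v x) :
    deriv^[2] f x = v := by
  have : deriv f =ᶠ[nhds x] f' := by
    filter_upwards [hs.mem_nhds hx] with y hy using (h1 y hy).deriv
  simp only [Function.iterate_succ, Function.iterate_zero, Function.comp, id]
  rw [this.deriv_eq, h2.deriv]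

/-- The summand `η(1 - p) - c η(p)` with `η(t) = -t log t`. -/
noncomputable def gapFun (c p : ℝ) : ℝ := negMulLog (1 - p) - c * negMulLog p

lemma gapFun_zero (c : ℝ) : gapFun c 0 = 0 := by simp [gapFun]

lemma gapFun_one (c : ℝ) : gapFun c 1 = 0 := by simp [gapFun]

lemma continuous_gapFun (c : ℝ) : Continuous (gapFun c) := by
  unfold gapFun
  fun_prop

lemma hasDerivAt_gapFun (c : ℝ) {p : ℝ} (h0 : 0 < p) (h1 : p < 1) :
    HasDerivAt (gapFun c) (log (1 - p) + 1 + c * (log p + 1)) p := by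
  have e1 : HasDerivAt (fun p : ℝ => 1 - p) (-1) p := by
    simpa using (hasDerivAt_id p).const_sub 1
  have h := ((hasDerivAt_negMulLog (sub_pos.2 h1).ne').comp p e1).sub
    ((hasDerivAt_negMulLog h0.ne').const_mul c)
  refine h.congr_deriv ?_
  ring

lemma hasDerivAt_gapFun_deriv (c : ℝ) {p : ℝ} (h0 : 0 < p) (h1 : p < 1) :
    HasDerivAt (fun p => log (1 - p) + 1 + c * (log p + 1)) (-1 / (1 - p) + c / p) p := by
  have e1 : HasDerivAt (fun p : ℝ => 1 - p) (-1) p := by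
    simpa using (hasDerivAt_id p).const_sub 1
  have h := ((e1.log (sub_pos.2 h1).ne').add_const 1).add
    (((hasDerivAt_log h0.ne').add_const 1).const_mul c)
  refine h.congr_deriv ?_
  simp [div_eq_mul_inv]

lemma deriv2_gapFun (c : ℝ) {p : ℝ} (h0 : 0 < p) (h1 : p < 1) :
    deriv^[2] (gapFun c) p = -1 / (1 - p) + c / p :=
  deriv_deriv_eq_of_hasDerivAt (s := Ioo 0 1) isOpen_Ioo ⟨h0, h1⟩
    (fun _ hy => hasDerivAt_gapFun c hy.1 hy.2) (hasDerivAt_gapFun_deriv c h0 h1)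

lemma strictConvexOn_gapFun {c : ℝ} (hc : 0 < c) :
    StrictConvexOn ℝ (Icc 0 (c / (1 + c))) (gapFun c) := by
  refine strictConvexOn_of_deriv2_pos (convex_Icc _ _) (continuous_gapFun c).continuousOn ?_
  intro x hx
  rw [interior_Icc] at hx
  obtain ⟨h0, h1⟩ := hx
  rw [lt_div_iff₀ (by positivity)] at h1
  have hx1 : x < 1 := by nlinarith
  rw [deriv2_gapFun c h0 hx1, div_add_div _ _ (by linarith) h0.ne']
  apply div_pos _ (mul_pos (by linarith) h0)
  nlinarith

lemma concaveOn_gapFun {c : ℝ} (hc : 0 < c) :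
    ConcaveOn ℝ (Icc (c / (1 + c)) 1) (gapFun c) := by
  refine (strictConcaveOn_of_deriv2_neg (convex_Icc _ _)
    (continuous_gapFun c).continuousOn ?_).concaveOn
  intro x hx
  rw [interior_Icc] at hx
  obtain ⟨h0, h1⟩ := hx
  have hx0 : 0 < x := lt_trans (by positivity) h0
  rw [div_lt_iff₀ (by positivity)] at h0
  rw [deriv2_gapFun c hx0 h1, div_add_div _ _ (by linarith) hx0.ne']
  apply div_neg_of_neg_of_pos _ (mul_pos (by linarith) hx0)
  nlinarith

/-- One atom of mass `1 - t` and `N` atoms of mass `t / N`. -/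
lemma gapFun_two_level_pos {N c : ℝ} (hN : 1 < N) (hcN : 1 < c * N) (hc1 : c < 1)
    (hc : c * log (N + 1) = N * (log (N + 1) - log N)) {t : ℝ} (ht0 : 0 < t)
    (ht1 : t < N / (N + 1)) :
    0 < gapFun c (1 - t) + N * gapFun c (t / N) := by
  have hN0 : 0 < N := by linarith
  have hc0 : 0 < c := by by_contra h; nlinarith
  set e := N / (N + 1) with he
  have he1 : e < 1 := by rw [he, div_lt_one (by linarith)]; linarith
  set t₀ := (1 - c) * N / (N - c) with ht₀
  have ht₀pos : 0 < t₀ := div_pos (mul_pos (by linarith) hN0) (by linarith)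
  have ht₀e : t₀ < e := by
    rw [ht₀, he, div_lt_div_iff₀ (by linarith) (by linarith)]
    nlinarith
  set Φ : ℝ → ℝ := fun t => gapFun c (1 - t) + N * gapFun c (t / N) with hΦ
  set Φ' : ℝ → ℝ := fun t => -(log (1 - (1 - t)) + 1 + c * (log (1 - t) + 1)) +
    (log (1 - t / N) + 1 + c * (log (t / N) + 1)) with hΦ'
  have hlt : ∀ t, t < 1 → t / N < 1 := fun t ht => by
    rw [div_lt_one hN0]; linarith
  have d0 : ∀ t : ℝ, HasDerivAt (fun t : ℝ => 1 - t) (-1) t := fun t => by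
    simpa using (hasDerivAt_id t).const_sub 1
  have d0' : ∀ t : ℝ, HasDerivAt (fun t : ℝ => t / N) (1 / N) t := fun t =>
    (hasDerivAt_id t).div_const N
  have d1 : ∀ t ∈ Ioo (0 : ℝ) 1, HasDerivAt Φ (Φ' t) t := by
    rintro t ⟨h0, h1⟩
    have a := (hasDerivAt_gapFun c (p := 1 - t) (by linarith) (by linarith)).comp t (d0 t)
    have b := ((hasDerivAt_gapFun c (p := t / N) (by positivity) (hlt t h1)).comp t
      (d0' t)).const_mul N
    refine (a.add b).congr_deriv ?_
    simp only [hΦ']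
    field_simp
  have d2 : ∀ t ∈ Ioo (0 : ℝ) 1, HasDerivAt Φ' (((N - c) * (t - t₀)) / (t * (1 - t) * (N - t))) t := by
    rintro t ⟨h0, h1⟩
    have a := (hasDerivAt_gapFun_deriv c (p := 1 - t) (by linarith) (by linarith)).comp t (d0 t)
    have b := (hasDerivAt_gapFun_deriv c (p := t / N) (by positivity) (hlt t h1)).comp t (d0' t)
    refine (a.neg.add b).congr_deriv ?_
    have e1 : N - c ≠ 0 := by linarith
    have e2 : 1 - t ≠ 0 := by linarith
    have e3 : N - t ≠ 0 := by linarith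
    have e4 : t ≠ 0 := h0.ne'
    have e5 : 1 - (1 - t) = t := by ring
    have e6 : 1 - t / N = (N - t) / N := by field_simp
    rw [e5, e6, ht₀]
    field_simp
    ring
  have hcont : Continuous Φ := by
    have := continuous_gapFun c
    simp only [hΦ]
    fun_prop
  have hΦ0 : Φ 0 = 0 := by simp [hΦ, gapFun_zero, gapFun_one]
  have le : log e = log N - log (N + 1) := log_div (by linarith) (by linarith)
  have l1 : 1 - e = 1 / (N + 1) := by rw [he]; field_simp; ring
  have l2 : e / N = 1 / (N + 1) := by rw [he]; field_simp
  have l3 : 1 - 1 / (N + 1) = e := by rw [he]; field_simp; ring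
  have l4 : log (1 / (N + 1)) = - log (N + 1) := by simp
  have hΦe : Φ e = 0 := by
    simp only [hΦ, gapFun, l1, l2, l3, negMulLog, le, l4]
    rw [he]
    field_simp
    linear_combination (-N - 1) * hc
  have hΦ'e : Φ' e = 0 := by
    simp only [hΦ', l1, l2, l3, l4]
    ring
  have anti : StrictAntiOn Φ (Icc t₀ e) := by
    refine strictAntiOn_of_deriv_neg (convex_Icc _ _) hcont.continuousOn ?_
    intro x hx
    rw [interior_Icc] at hx
    have mono : StrictMonoOn Φ' (Icc t₀ e) := by
      refine strictMonoOn_of_deriv_pos (convex_Icc _ _) ?_ ?_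
      · intro y hy
        exact (d2 y ⟨ht₀pos.trans_le hy.1, hy.2.trans_lt he1⟩).continuousAt.continuousWithinAt
      · intro y hy
        rw [interior_Icc] at hy
        have hy0 := ht₀pos.trans hy.1
        have hy1 := hy.2.trans he1
        rw [(d2 y ⟨hy0, hy1⟩).deriv]
        exact div_pos (mul_pos (by linarith) (by linarith [hy.1]))
          (mul_pos (mul_pos hy0 (by linarith)) (by linarith))
    rw [(d1 x ⟨ht₀pos.trans hx.1, hx.2.trans he1⟩).deriv, ← hΦ'e]
    exact mono ⟨hx.1.le, hx.2.le⟩ ⟨ht₀e.le, le_rfl⟩ hx.2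
  have conc : StrictConcaveOn ℝ (Icc 0 t₀) Φ := by
    refine strictConcaveOn_of_deriv2_neg (convex_Icc _ _) hcont.continuousOn ?_
    intro x hx
    rw [interior_Icc] at hx
    have hx1 := hx.2.trans (ht₀e.trans he1)
    rw [deriv_deriv_eq_of_hasDerivAt (s := Ioo 0 1) isOpen_Ioo ⟨hx.1, hx1⟩ d1 (d2 x ⟨hx.1, hx1⟩)]
    exact div_neg_of_neg_of_pos (mul_neg_of_pos_of_neg (by linarith) (by linarith [hx.2]))
      (mul_pos (mul_pos hx.1 (by linarith)) (by linarith))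
  have hΦt₀ : 0 < Φ t₀ := by
    rw [← hΦe]; exact anti ⟨le_rfl, ht₀e.le⟩ ⟨ht₀e.le, le_rfl⟩ ht₀e
  change 0 < Φ t
  rcases lt_or_ge t t₀ with h | h
  · have h1 : 0 ≤ 1 - t / t₀ := by rw [sub_nonneg, div_le_one ht₀pos]; exact h.le
    have h2 : 0 ≤ t / t₀ := by positivity
    have := conc.concaveOn.2 (Set.left_mem_Icc.2 ht₀pos.le) (Set.right_mem_Icc.2 ht₀pos.le)
      h1 h2 (by ring)
    simp only [smul_eq_mul, hΦ0, mul_zero, zero_add, div_mul_cancel₀ _ ht₀pos.ne'] at this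
    exact lt_of_lt_of_le (by positivity) this
  · rw [← hΦe]; exact anti ⟨h, ht1.le⟩ ⟨ht₀e.le, le_rfl⟩ ht1

/-- The sharp comparison constant for distributions on `n` points. -/
lemma exists_gap_const {n : ℕ} (hn : 3 ≤ n) : ∃ c : ℝ, 1 < c * ((n : ℝ) - 1) ∧ c < 1 ∧
    c * log n = ((n : ℝ) - 1) * (log n - log ((n : ℝ) - 1)) := by
  have hn' : (3 : ℝ) ≤ n := by exact_mod_cast hn
  have hlog : 1 < log n := by
    rw [lt_log_iff_exp_lt (by linarith)]
    linarith [exp_one_lt_three]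
  have h1 : log n - log ((n : ℝ) - 1) = log (n / ((n : ℝ) - 1)) :=
    (log_div (by linarith) (by linarith)).symm
  have hup : ((n : ℝ) - 1) * (log n - log ((n : ℝ) - 1)) ≤ 1 := by
    have := log_le_sub_one_of_pos (x := n / ((n : ℝ) - 1)) (div_pos (by linarith) (by linarith))
    rw [← h1] at this
    calc _ ≤ ((n : ℝ) - 1) * (n / ((n : ℝ) - 1) - 1) :=
          mul_le_mul_of_nonneg_left this (by linarith)
      _ = 1 := by
          have : (n : ℝ) - 1 ≠ 0 := by linarith
          field_simp; ring
  have hlow : 1 / (n : ℝ) ≤ log n - log ((n : ℝ) - 1) := by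
    have := one_sub_inv_le_log_of_pos (x := n / ((n : ℝ) - 1)) (div_pos (by linarith) (by linarith))
    rw [← h1] at this
    refine le_trans (le_of_eq ?_) this
    have : (n : ℝ) - 1 ≠ 0 := by linarith
    field_simp; ring
  have hlogup : log n * n < ((n : ℝ) - 1) ^ 2 := by
    have h2 : log (n / 3) ≤ n / 3 - 1 := log_le_sub_one_of_pos (by linarith)
    rw [log_div (by linarith) (by norm_num)] at h2
    have h3 : log 3 < 1.2 := by
      have e : log (3 : ℝ) = log (3 / 2) + log 2 := by
        rw [← log_mul (by norm_num) (by norm_num)]; norm_num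
      have e2 := log_le_sub_one_of_pos (x := (3 / 2 : ℝ)) (by norm_num)
      linarith [log_two_lt_d9]
    nlinarith
  refine ⟨((n : ℝ) - 1) * (log n - log ((n : ℝ) - 1)) / log n, ?_, ?_, ?_⟩
  · rw [div_mul_eq_mul_div, lt_div_iff₀ (by linarith), one_mul]
    have : ((n : ℝ) - 1) ^ 2 * (1 / n) ≤ ((n : ℝ) - 1) ^ 2 * (log n - log ((n : ℝ) - 1)) :=
      mul_le_mul_of_nonneg_left hlow (sq_nonneg _)
    have h5 : log n < ((n : ℝ) - 1) ^ 2 * (1 / n) := by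
      rw [mul_one_div, lt_div_iff₀ (by linarith)]; exact hlogup
    nlinarith
  · rw [div_lt_one (by linarith)]; linarith
  · field_simp

lemma sum_gapFun_nonneg {ι : Type*} [DecidableEq ι] {B : Finset ι} (hB : 3 ≤ B.card) {c : ℝ}
    (hcn : 1 < c * ((B.card : ℝ) - 1)) (hc1 : c < 1)
    (hc : c * log B.card = ((B.card : ℝ) - 1) * (log B.card - log ((B.card : ℝ) - 1)))
    {p : ι → ℝ} (hp : ∀ y ∈ B, 0 ≤ p y) (hsum : ∑ y ∈ B, p y = 1) :
    0 ≤ ∑ y ∈ B, gapFun c (p y) ∧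
      (∑ y ∈ B, gapFun c (p y) = 0 → (∃ y ∈ B, p y = 1) ∨ ∀ y ∈ B, p y = 1 / B.card) := by
  set n : ℝ := (B.card : ℝ) with hn
  have hn3 : (3 : ℝ) ≤ n := by rw [hn]; exact_mod_cast hB
  have hc0 : 0 < c := by by_contra h; nlinarith
  set a := c / (1 + c) with ha
  have ha0 : 0 < a := by positivity
  have ha1 : a < 1 := by rw [ha, div_lt_one (by linarith)]; linarith
  have hna : 1 / n < a := by
    rw [ha, div_lt_div_iff₀ (by linarith) (by linarith)]; nlinarith
  have hconv := strictConvexOn_gapFun hc0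
  have hconc := concaveOn_gapFun hc0
  by_cases hall : ∀ y ∈ B, p y ≤ a
  · have hw : ∑ _y ∈ B, 1 / n = 1 := by
      rw [sum_const, nsmul_eq_mul, ← hn]; field_simp
    have hwp : ∑ y ∈ B, (1 / n) • p y = 1 / n := by
      rw [← smul_sum, hsum]; simp
    have hmem : ∀ y ∈ B, p y ∈ Icc 0 a := fun y hy => ⟨hp y hy, hall y hy⟩
    have h0 : gapFun c (1 / n) = 0 := by
      have e : 1 - 1 / n = (n - 1) / n := by field_simp
      simp only [gapFun, negMulLog, e]
      rw [log_div (by linarith) (by linarith), one_div, log_inv]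
      field_simp
      linear_combination (-1) * hc
    have hJ := hconv.convexOn.map_sum_le (t := B) (w := fun _ => 1 / n) (p := p)
      (fun _ _ => by positivity) hw hmem
    have hE := hconv.map_sum_eq_iff (t := B) (w := fun _ => 1 / n) (p := p)
      (fun _ _ => by positivity) hw hmem
    rw [hwp, h0, ← smul_sum, smul_eq_mul] at hJ hE
    refine ⟨nonneg_of_mul_nonneg_right hJ (by positivity), fun h => Or.inr ?_⟩
    exact hE.1 (by rw [h, mul_zero])
  · push Not at hall
    obtain ⟨y₀, hy₀, hlt⟩ := hall
    set q : ι → ℝ := fun y => min (p y) a with hq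
    have hq0 : ∀ y ∈ B, 0 ≤ q y := fun y hy => le_min (hp y hy) ha0.le
    have hqy₀ : q y₀ = a := min_eq_right hlt.le
    have hd : ∀ y ∈ B, 0 ≤ p y - q y := fun y _ => sub_nonneg.2 (min_le_left _ _)
    set R := a + ∑ y ∈ B, (p y - q y) with hR
    have hRq : R + ∑ y ∈ B.erase y₀, q y = 1 := by
      rw [hR, sum_sub_distrib, hsum, ← add_sum_erase B q hy₀, hqy₀]; ring
    have hqe : ∀ y ∈ B.erase y₀, 0 ≤ q y := fun y hy => hq0 y (mem_of_mem_erase hy)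
    have hR1 : R ≤ 1 := by linarith [sum_nonneg hqe]
    have hle : ∀ y ∈ B, a + (p y - q y) ≤ R := fun y hy => by
      rw [hR]; gcongr; exact single_le_sum (f := fun y => p y - q y) hd hy
    have hRa : a < R := by have := hle y₀ hy₀; rw [hqy₀] at this; linarith
    set s := (gapFun c R - gapFun c a) / (R - a) with hs
    have hsR : s * (R - a) = gapFun c R - gapFun c a := div_mul_cancel₀ _ (by linarith)
    have hpt : ∀ y ∈ B, gapFun c (q y) + s * (p y - q y) ≤ gapFun c (p y) := by
      intro y hy
      rcases le_or_gt (p y) a with h | h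
      · have : q y = p y := min_eq_left h
        simp [this]
      · have hqa : q y = a := min_eq_right h.le
        have hyR := hle y hy
        rw [hqa] at hyR ⊢
        have hRa' : 0 < R - a := by linarith
        have h1 : 0 ≤ (R - p y) / (R - a) := div_nonneg (by linarith) hRa'.le
        have h2 : 0 ≤ (p y - a) / (R - a) := div_nonneg (by linarith) hRa'.le
        have := hconc.2 (Set.left_mem_Icc.2 ha1.le) (Set.mem_Icc.2 ⟨hRa.le, hR1⟩) h1 h2
          (by field_simp; ring)
        have e : ((R - p y) / (R - a)) • a + ((p y - a) / (R - a)) • R = p y := by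
          simp only [smul_eq_mul]; field_simp; ring
        rw [e] at this
        refine le_trans (le_of_eq ?_) this
        simp only [smul_eq_mul, hs]
        field_simp
        ring
    have hsum1 : gapFun c R + ∑ y ∈ B.erase y₀, gapFun c (q y) ≤ ∑ y ∈ B, gapFun c (p y) := by
      have := sum_le_sum hpt
      rw [sum_add_distrib, ← mul_sum, ← add_sum_erase B (fun y => gapFun c (q y)) hy₀, hqy₀] at this
      have e : ∑ y ∈ B, (p y - q y) = R - a := by rw [hR]; ring
      rw [e, hsR] at this
      linarith
    have hcard : ((B.erase y₀).card : ℝ) = n - 1 := by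
      rw [card_erase_of_mem hy₀, Nat.cast_sub (by lia), hn]; simp
    have hn1 : 0 < n - 1 := by linarith
    have hJ : (n - 1) * gapFun c ((1 - R) / (n - 1)) ≤ ∑ y ∈ B.erase y₀, gapFun c (q y) := by
      have := hconv.convexOn.map_sum_le (t := B.erase y₀) (w := fun _ => 1 / (n - 1)) (p := q)
        (fun _ _ => by positivity) (by rw [sum_const, nsmul_eq_mul, hcard]; field_simp)
        (fun y hy => ⟨hqe y hy, min_le_right _ _⟩)
      rw [← smul_sum, ← smul_sum, eq_sub_iff_add_eq'.2 hRq, smul_eq_mul, smul_eq_mul,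
        one_div_mul_eq_div, one_div_mul_eq_div, le_div_iff₀ hn1] at this
      linarith
    rcases hR1.lt_or_eq with h1 | h1
    · have := gapFun_two_level_pos (N := n - 1) (c := c) (by linarith) hcn hc1
        (by rw [sub_add_cancel]; exact hc) (t := 1 - R) (by linarith)
        (by
          rw [sub_add_cancel]
          have : (n - 1) / n = 1 - 1 / n := by field_simp
          rw [this]; linarith)
      rw [sub_sub_cancel] at this
      exact ⟨by linarith, fun h => by linarith⟩
    · rw [h1] at hsum1 hJ hRq
      simp only [sub_self, zero_div, gapFun_zero, gapFun_one, mul_zero, zero_add] at hsum1 hJ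
      refine ⟨by linarith, fun _ => Or.inl ⟨y₀, hy₀, ?_⟩⟩
      have hz := (sum_eq_zero_iff_of_nonneg hqe).1 (by linarith)
      rw [← hsum, ← add_sum_erase B p hy₀, sum_eq_zero, add_zero]
      intro y hy
      have h := hz y hy
      simp only [hq] at h
      rcases min_choice (p y) a with h' | h' <;> rw [h'] at h
      · exact h
      · exact absurd h ha0.ne'

/-- Strong data processing for the uniform move to a different point. -/
lemma entropy_complement_ge {ι : Type*} [DecidableEq ι] {B : Finset ι} (hB : 2 ≤ B.card)
    {p : ι → ℝ} (hp : ∀ y ∈ B, 0 ≤ p y) (hsum : ∑ y ∈ B, p y = 1) :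
    ((B.card : ℝ) - 1) * (log B.card - log ((B.card : ℝ) - 1)) * ∑ y ∈ B, negMulLog (p y) ≤
      log B.card * ∑ y ∈ B, negMulLog (1 - p y) ∧
    (3 ≤ B.card →
      ((B.card : ℝ) - 1) * (log B.card - log ((B.card : ℝ) - 1)) * ∑ y ∈ B, negMulLog (p y) =
        log B.card * ∑ y ∈ B, negMulLog (1 - p y) →
      (∃ y ∈ B, p y = 1) ∨ ∀ y ∈ B, p y = 1 / B.card) := by
  rcases hB.eq_or_lt with h2 | h3
  · refine ⟨?_, fun h => by lia⟩
    obtain ⟨x, y, hxy, rfl⟩ := card_eq_two.1 h2.symm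
    rw [sum_pair hxy] at hsum
    have e1 : 1 - p x = p y := by linarith
    have e2 : 1 - p y = p x := by linarith
    rw [sum_pair hxy, sum_pair hxy, e1, e2, ← h2]
    norm_num
    linarith
  · obtain ⟨c, hcn, hc1, hc⟩ := exists_gap_const (n := B.card) h3
    obtain ⟨h, h'⟩ := sum_gapFun_nonneg (B := B) h3 hcn hc1 hc hp hsum
    have hlog : 0 < log (B.card : ℝ) := log_pos (by exact_mod_cast (by lia : 1 < B.card))
    have e : ∑ y ∈ B, gapFun c (p y) =
        ∑ y ∈ B, negMulLog (1 - p y) - c * ∑ y ∈ B, negMulLog (p y) := by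
      simp only [gapFun, sum_sub_distrib, mul_sum]
    rw [← hc]
    rw [e] at h h'
    refine ⟨by nlinarith, fun _ heq => h' ?_⟩
    have : log (B.card : ℝ) *
        (∑ y ∈ B, negMulLog (1 - p y) - c * ∑ y ∈ B, negMulLog (p y)) = 0 := by linarith
    exact (mul_eq_zero.1 this).resolve_left hlog.ne'

end Analytic
section Pair

variable {V : Type*} [DecidableEq V]

/-- The mass that `f` restricted to `F` gives to `τ x = y`. -/
noncomputable def marg (F : Finset (Equiv.Perm V)) (f : Equiv.Perm V → ℝ) (x y : V) : ℝ :=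
  ∑ τ ∈ F with τ x = y, f τ

/-- The mass that `f` restricted to `F` gives to `τ x = y`, `τ z = y'`. -/
noncomputable def joint (F : Finset (Equiv.Perm V)) (f : Equiv.Perm V → ℝ) (x z y y' : V) : ℝ :=
  ∑ τ ∈ F with τ x = y ∧ τ z = y', f τ

variable {F : Finset (Equiv.Perm V)} {f : Equiv.Perm V → ℝ}

lemma marg_nonneg (hf : ∀ σ, 0 ≤ f σ) (x y : V) : 0 ≤ marg F f x y :=
  sum_nonneg fun σ _ => hf σ

lemma joint_nonneg (hf : ∀ σ, 0 ≤ f σ) (x z y y' : V) : 0 ≤ joint F f x z y y' :=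
  sum_nonneg fun σ _ => hf σ

lemma marg_pos (hf : ∀ σ, 0 ≤ f σ) {τ : Equiv.Perm V} (hτ : τ ∈ F) (h : 0 < f τ) (x : V) :
    0 < marg F f x (τ x) :=
  h.trans_le (single_le_sum (f := f) (fun σ _ => hf σ) (by simp [hτ]))

lemma joint_pos (hf : ∀ σ, 0 ≤ f σ) {τ : Equiv.Perm V} (hτ : τ ∈ F) (h : 0 < f τ) (x z : V) :
    0 < joint F f x z (τ x) (τ z) :=
  h.trans_le (single_le_sum (f := f) (fun σ _ => hf σ) (by simp [hτ]))

lemma joint_self_eq_zero {x z : V} (hxz : x ≠ z) (y : V) : joint F f x z y y = 0 := by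
  rw [joint, filter_false_of_mem, sum_empty]
  rintro τ _ ⟨h1, h2⟩
  exact hxz (τ.injective (h1.trans h2.symm))

variable [Fintype V]

lemma sum_mul_marg (x : V) (g : V → ℝ) :
    ∑ τ ∈ F, f τ * g (τ x) = ∑ y, marg F f x y * g y := by
  rw [← sum_fiberwise F (fun τ => τ x)]
  refine sum_congr rfl fun y _ => ?_
  rw [marg, sum_mul]
  refine sum_congr rfl fun τ hτ => ?_
  rw [(mem_filter.1 hτ).2]

lemma sum_marg (x : V) : ∑ y, marg F f x y = ∑ τ ∈ F, f τ := by
  simpa using (sum_mul_marg (F := F) (f := f) x (fun _ => 1)).symm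

lemma sum_mul_joint (x z : V) (g : V → V → ℝ) :
    ∑ τ ∈ F, f τ * g (τ x) (τ z) = ∑ y, ∑ y', joint F f x z y y' * g y y' := by
  rw [← sum_fiberwise F (fun τ => τ x)]
  refine sum_congr rfl fun y _ => ?_
  rw [← sum_fiberwise _ (fun τ => τ z)]
  refine sum_congr rfl fun y' _ => ?_
  rw [joint, sum_mul, filter_filter]
  refine sum_congr rfl fun τ hτ => ?_
  rw [(mem_filter.1 hτ).2.1, (mem_filter.1 hτ).2.2]

lemma marg_le_sub_marg (hf : ∀ σ, 0 ≤ f σ) (x : V) {y y' : V} (h : y ≠ y') :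
    marg F f x y' ≤ ∑ τ ∈ F, f τ - marg F f x y := by
  rw [← sum_marg x, ← add_sum_erase univ _ (mem_univ y), add_sub_cancel_left]
  exact single_le_sum (f := marg F f x) (fun _ _ => marg_nonneg hf x _) (by simp [h.symm])

/-- The conditional entropy of `τ z` given `τ x` is at most its cross entropy relative to the
law of `τ z` conditioned to differ from `τ x`. -/
lemma sum_log_cond_ge (hf : ∀ σ, 0 ≤ f σ) {x z : V} (hxz : x ≠ z) :
    ∑ τ ∈ F, f τ * (Real.log (marg F f z (τ z)) -
        Real.log (∑ τ ∈ F, f τ - marg F f z (τ x))) ≤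
      ∑ τ ∈ F, f τ * (Real.log (joint F f x z (τ x) (τ z)) - Real.log (marg F f x (τ x))) := by
  set M := ∑ τ ∈ F, f τ with hM
  set q : V → V → ℝ := fun y y' => marg F f z y' / (M - marg F f z y) with hq
  set ρ : V → V → ℝ := fun y y' => q y y' * marg F f x y / joint F f x z y y' with hρ
  have hq0 : ∀ y y', y ≠ y' → 0 ≤ q y y' := fun y y' h =>
    div_nonneg (marg_nonneg hf _ _) ((marg_nonneg hf _ _).trans (marg_le_sub_marg hf z h))
  have hmass : ∑ τ ∈ F, f τ * ρ (τ x) (τ z) ≤ M := by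
    rw [sum_mul_joint x z ρ, hM, ← sum_marg x]
    refine sum_le_sum fun y _ => ?_
    have hqs : ∑ y' ∈ univ.erase y, q y y' ≤ 1 := by
      simp only [hq]
      rw [← sum_div]
      have : ∑ y' ∈ univ.erase y, marg F f z y' = M - marg F f z y := by
        rw [hM, ← sum_marg z, ← add_sum_erase univ _ (mem_univ y), add_sub_cancel_left]
      rw [this]
      exact div_self_le_one _
    calc ∑ y', joint F f x z y y' * ρ y y'
        ≤ ∑ y' ∈ univ.erase y, q y y' * marg F f x y := by
          rw [← add_sum_erase univ _ (mem_univ y), joint_self_eq_zero hxz, zero_mul, zero_add]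
          refine sum_le_sum fun y' hy' => ?_
          have hyy : y ≠ y' := (ne_of_mem_erase hy').symm
          have h0 := mul_nonneg (hq0 y y' hyy) (marg_nonneg (F := F) hf x y)
          rcases eq_or_ne (joint F f x z y y') 0 with h | h
          · rw [h, zero_mul]; exact h0
          · simp only [hρ]; rw [mul_div_cancel₀ _ h]
      _ = (∑ y' ∈ univ.erase y, q y y') * marg F f x y := by rw [sum_mul]
      _ ≤ marg F f x y := mul_le_of_le_one_left (marg_nonneg hf _ _) hqs
  have hterm : ∀ τ ∈ F, f τ * (Real.log (marg F f z (τ z)) - Real.log (M - marg F f z (τ x))) +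
      (f τ - f τ * ρ (τ x) (τ z)) ≤
      f τ * (Real.log (joint F f x z (τ x) (τ z)) - Real.log (marg F f x (τ x))) := by
    intro τ hτ
    rcases (hf τ).eq_or_lt with h | h
    · simp [← h]
    · have hJ := joint_pos hf hτ h x z
      have hm := marg_pos hf hτ h z
      have hr := marg_pos hf hτ h x
      have hne : τ x ≠ τ z := fun e => hxz (τ.injective e)
      have hd : 0 < M - marg F f z (τ x) := hm.trans_le (marg_le_sub_marg hf z hne)
      have hqp : 0 < q (τ x) (τ z) := div_pos hm hd
      have hlog := Real.log_le_sub_one_of_pos (x := ρ (τ x) (τ z))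
        (div_pos (mul_pos hqp hr) hJ)
      have e : Real.log (ρ (τ x) (τ z)) = Real.log (marg F f z (τ z)) -
          Real.log (M - marg F f z (τ x)) + Real.log (marg F f x (τ x)) -
          Real.log (joint F f x z (τ x) (τ z)) := by
        simp only [hρ, hq]
        rw [Real.log_div (mul_pos hqp hr).ne' hJ.ne', Real.log_mul hqp.ne' hr.ne',
          Real.log_div hm.ne' hd.ne']
      rw [e] at hlog
      nlinarith
  have := sum_le_sum hterm
  rw [sum_add_distrib, sum_sub_distrib] at this
  linarith

/-- Comparison, for a fixed site `z`, of the pairwise and the single-site relative entropies of a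
mass function on permutations that map the block `A` onto `B`. -/
lemma pair_comparison (hf : ∀ σ, 0 ≤ f σ) {A B : Finset V}
    (hAB : ∀ τ ∈ F, A.image τ = B) (hcard : A.card = B.card) (hA : 2 ≤ A.card) {z : V}
    (hz : z ∈ A) :
    ((A.card : ℝ) - 1) * Real.log ((A.card : ℝ) - 1) *
        ∑ τ ∈ F, f τ * (Real.log (marg F f z (τ z)) - Real.log (∑ τ ∈ F, f τ)) ≤
      Real.log A.card * ∑ x ∈ A.erase z, ∑ τ ∈ F,
        f τ * (Real.log (joint F f x z (τ x) (τ z)) - Real.log (marg F f x (τ x))) ∧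
    (3 ≤ A.card → ∑ τ ∈ F, f τ ≠ 0 →
      ((A.card : ℝ) - 1) * Real.log ((A.card : ℝ) - 1) *
        ∑ τ ∈ F, f τ * (Real.log (marg F f z (τ z)) - Real.log (∑ τ ∈ F, f τ)) =
      Real.log A.card * ∑ x ∈ A.erase z, ∑ τ ∈ F,
        f τ * (Real.log (joint F f x z (τ x) (τ z)) - Real.log (marg F f x (τ x))) →
      (∃ y ∈ B, marg F f z y = ∑ τ ∈ F, f τ) ∨
        ∀ y ∈ B, marg F f z y = (∑ τ ∈ F, f τ) / A.card) := by
  rcases eq_or_ne (∑ τ ∈ F, f τ) 0 with hM0 | hM0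
  · have hz0 : ∀ τ ∈ F, f τ = 0 := (sum_eq_zero_iff_of_nonneg fun τ _ => hf τ).1 hM0
    refine ⟨le_of_eq ?_, fun _ h => absurd hM0 h⟩
    rw [sum_eq_zero fun τ hτ => by rw [hz0 τ hτ, zero_mul],
      sum_eq_zero fun x _ => sum_eq_zero fun τ hτ => by rw [hz0 τ hτ, zero_mul], mul_zero, mul_zero]
  set M := ∑ τ ∈ F, f τ with hM
  have hMpos : 0 < M := lt_of_le_of_ne (sum_nonneg fun τ _ => hf τ) hM0.symm
  have hmemB : ∀ τ ∈ F, ∀ x ∈ A, τ x ∈ B := fun τ hτ x hx => by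
    rw [← hAB τ hτ]; exact mem_image_of_mem _ hx
  have hout : ∀ y ∉ B, marg F f z y = 0 := fun y hy => by
    rw [marg, filter_false_of_mem, sum_empty]
    rintro τ hτ rfl
    exact hy (hmemB τ hτ z hz)
  have hsumB : ∀ g : V → ℝ, ∑ y, marg F f z y * g y = ∑ y ∈ B, marg F f z y * g y := fun g =>
    (sum_subset (subset_univ B) fun y _ hy => by rw [hout y hy, zero_mul]).symm
  set p : V → ℝ := fun y => marg F f z y / M with hp
  have hpM : ∀ y, marg F f z y = M * p y := fun y => by simp only [hp]; field_simp
  have hp0 : ∀ y ∈ B, 0 ≤ p y := fun y _ => div_nonneg (marg_nonneg hf _ _) hMpos.le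
  have hp1 : ∑ y ∈ B, p y = 1 := by
    have := hsumB fun _ => 1
    simp only [mul_one] at this
    simp only [hp]
    rw [← sum_div, ← this, sum_marg, ← hM, div_self hM0]
  have hlogsub : ∀ t : ℝ, M * t * (Real.log (M * t) - Real.log M) = - (M * Real.negMulLog t) := by
    intro t
    rcases eq_or_ne t 0 with h | h
    · simp [h]
    · rw [Real.log_mul hM0 h, Real.negMulLog]; ring
  have hone : ∑ τ ∈ F, f τ * (Real.log (marg F f z (τ z)) - Real.log M) =
      - (M * ∑ y ∈ B, Real.negMulLog (p y)) := by
    rw [sum_mul_marg z (fun y => Real.log (marg F f z y) - Real.log M), hsumB, mul_sum,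
      ← sum_neg_distrib]
    refine sum_congr rfl fun y _ => ?_
    rw [hpM, hlogsub]
  set G : V → ℝ := fun y => Real.log (M - marg F f z y) - Real.log M with hG
  have htwo : ∑ x ∈ A.erase z, ∑ τ ∈ F, f τ * G (τ x) =
      - (M * ∑ y ∈ B, Real.negMulLog (1 - p y)) := by
    rw [sum_comm]
    have e1 : ∀ τ ∈ F, ∑ x ∈ A.erase z, f τ * G (τ x) =
        f τ * ∑ y ∈ B, G y - f τ * G (τ z) := by
      intro τ hτ
      rw [← mul_sum, ← mul_sub]
      congr 1
      rw [← hAB τ hτ, sum_image (fun x _ y _ h => τ.injective h),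
        ← add_sum_erase A (fun x => G (τ x)) hz, add_sub_cancel_left]
    rw [sum_congr rfl e1, sum_sub_distrib, ← sum_mul, ← hM, sum_mul_marg z G, hsumB, mul_sum,
      mul_sum, ← sum_sub_distrib, ← sum_neg_distrib]
    refine sum_congr rfl fun y _ => ?_
    have h := hlogsub (1 - p y)
    simp only [hG, hpM]
    rw [mul_one_sub] at h
    linarith
  have hlow : ((A.card : ℝ) - 1) * -(M * ∑ y ∈ B, Real.negMulLog (p y)) +
      M * ∑ y ∈ B, Real.negMulLog (1 - p y) ≤ ∑ x ∈ A.erase z, ∑ τ ∈ F,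
        f τ * (Real.log (joint F f x z (τ x) (τ z)) - Real.log (marg F f x (τ x))) := by
    have h := sum_le_sum fun x (hx : x ∈ A.erase z) =>
      sum_log_cond_ge (F := F) hf (ne_of_mem_erase hx)
    refine le_trans (le_of_eq ?_) h
    have e : ∀ x ∈ A.erase z, ∑ τ ∈ F, f τ * (Real.log (marg F f z (τ z)) -
        Real.log (∑ τ ∈ F, f τ - marg F f z (τ x))) =
        -(M * ∑ y ∈ B, Real.negMulLog (p y)) - ∑ τ ∈ F, f τ * G (τ x) := by
      intro x _
      rw [← hone, ← sum_sub_distrib]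
      refine sum_congr rfl fun τ _ => ?_
      simp only [hG, hM]
      ring
    rw [sum_congr rfl e, sum_sub_distrib, htwo, sum_const, card_erase_of_mem hz, nsmul_eq_mul,
      Nat.cast_sub (by lia)]
    push_cast
    ring
  obtain ⟨hk, hk'⟩ := entropy_complement_ge (hcard ▸ hA) hp0 hp1
  rw [← hcard] at hk hk'
  have hlog : 0 < Real.log (A.card : ℝ) := Real.log_pos (by exact_mod_cast (by lia : 1 < A.card))
  rw [hone]
  have hlow' := mul_le_mul_of_nonneg_left hlow hlog.le
  have hkM := mul_le_mul_of_nonneg_left hk hMpos.le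
  refine ⟨by linarith, fun h3 _ heq => ?_⟩
  have hkeq : M * (((A.card : ℝ) - 1) * (Real.log A.card - Real.log ((A.card : ℝ) - 1)) *
      ∑ y ∈ B, Real.negMulLog (p y)) =
      M * (Real.log A.card * ∑ y ∈ B, Real.negMulLog (1 - p y)) :=
    le_antisymm hkM (by linarith)
  rcases hk' h3 (mul_left_cancel₀ hM0 hkeq) with ⟨y, hy, h⟩ | h
  · exact Or.inl ⟨y, hy, by rw [hpM, h, mul_one]⟩
  · exact Or.inr fun y hy => by rw [hpM, h y hy, mul_one_div]

end Pair

section Block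

variable {V : Type*} [Fintype V] [DecidableEq V] {A : Finset V} {f : Equiv.Perm V → ℝ}

lemma mem_permFiber {σ τ : Equiv.Perm V} : τ ∈ permFiber A σ ↔ ∀ z ∉ A, τ z = σ z := by
  simp [permFiber]

lemma self_mem_permFiber (A : Finset V) (σ : Equiv.Perm V) : σ ∈ permFiber A σ :=
  mem_permFiber.2 fun _ _ => rfl

lemma mem_permFiber_comm {σ τ : Equiv.Perm V} : τ ∈ permFiber A σ ↔ σ ∈ permFiber A τ := by
  simp only [mem_permFiber, eq_comm]

lemma permFiber_congr {σ τ : Equiv.Perm V} (h : τ ∈ permFiber A σ) :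
    permFiber A τ = permFiber A σ := by
  ext ρ
  rw [mem_permFiber] at h
  simp only [mem_permFiber]
  exact forall₂_congr fun z hz => by rw [h z hz]

lemma permFiber_univ (σ : Equiv.Perm V) : permFiber univ σ = univ := by
  ext; simp [mem_permFiber]

lemma card_permFiber (A : Finset V) (σ : Equiv.Perm V) :
    (permFiber A σ).card = A.card.factorial := by
  have h1 : (permFiber A σ).card = (permFiber A 1).card := by
    refine card_bij' (fun τ _ => σ⁻¹ * τ) (fun τ _ => σ * τ) ?_ ?_ ?_ ?_
    · intro τ hτ
      rw [mem_permFiber] at hτ ⊢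
      intro z hz
      simp [hτ z hz]
    · intro τ hτ
      rw [mem_permFiber] at hτ ⊢
      intro z hz
      simp [hτ z hz]
    · intro τ _; simp
    · intro τ _; simp
  rw [h1, ← Fintype.card_coe A, ← Fintype.card_perm,
    Fintype.card_congr (Equiv.Perm.subtypeEquivSubtypePerm (· ∈ A)), Fintype.card_subtype]
  rfl

lemma card_permFiber_pos (A : Finset V) (σ : Equiv.Perm V) :
    (0 : ℝ) < (permFiber A σ).card := by
  rw [card_permFiber]; exact_mod_cast Nat.factorial_pos _

lemma sum_permFiber_average (A : Finset V) (g : Equiv.Perm V → ℝ) :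
    ∑ σ, (∑ τ ∈ permFiber A σ, g τ) / ((permFiber A σ).card : ℝ) = ∑ τ, g τ := by
  simp only [sum_div]
  rw [sum_comm' (t' := univ) (s' := fun τ => permFiber A τ)
    (by intro σ τ; simpa using mem_permFiber_comm)]
  refine sum_congr rfl fun τ _ => ?_
  rw [sum_congr rfl (g := fun _ => g τ / ((permFiber A τ).card : ℝ))
    fun σ hσ => by rw [permFiber_congr hσ], sum_const, nsmul_eq_mul]
  have := (card_permFiber_pos A τ).ne'
  field_simp

/-- The unnormalised averaged entropy of the block `A`. -/
noncomputable def blockEnt (A : Finset V) (f : Equiv.Perm V → ℝ) : ℝ :=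
  ∑ σ, f σ * Real.log (f σ / condExp A f σ)

/-- The mass of the fiber of `σ`. -/
noncomputable def fiberSum (A : Finset V) (f : Equiv.Perm V → ℝ) (σ : Equiv.Perm V) : ℝ :=
  ∑ τ ∈ permFiber A σ, f τ

lemma mean_EntA (A : Finset V) (f : Equiv.Perm V → ℝ) :
    mean (EntA A f) = blockEnt A f / Fintype.card (Equiv.Perm V) := by
  rw [mean, blockEnt, ← sum_permFiber_average A fun σ => f σ * Real.log (f σ / condExp A f σ)]
  congr 1
  refine sum_congr rfl fun σ _ => ?_
  rw [EntA]
  congr 1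
  refine sum_congr rfl fun τ hτ => ?_
  rw [condExp, condExp, permFiber_congr hτ]

lemma Ent_eq_blockEnt (f : Equiv.Perm V → ℝ) :
    Ent f = blockEnt univ f / Fintype.card (Equiv.Perm V) := by
  rw [Ent, mean, blockEnt]
  simp [condExp, permFiber_univ, mean]

lemma fiberSum_pos (hf : ∀ σ, 0 ≤ f σ) (A : Finset V) {σ : Equiv.Perm V} (h : 0 < f σ) :
    0 < fiberSum A f σ :=
  h.trans_le (single_le_sum (f := f) (fun τ _ => hf τ) (self_mem_permFiber A σ))

lemma blockEnt_eq (hf : ∀ σ, 0 ≤ f σ) (A : Finset V) :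
    blockEnt A f = ∑ σ, f σ * Real.log (f σ) + Real.log A.card.factorial * ∑ σ, f σ -
      ∑ σ, f σ * Real.log (fiberSum A f σ) := by
  rw [blockEnt, mul_sum, ← sum_add_distrib, ← sum_sub_distrib]
  refine sum_congr rfl fun σ _ => ?_
  rcases (hf σ).eq_or_lt with h | h
  · simp [← h]
  · have h1 := fiberSum_pos hf A h
    have h2 := card_permFiber_pos A σ
    have h3 : condExp A f σ = fiberSum A f σ / ((permFiber A σ).card : ℝ) := rfl
    rw [h3, Real.log_div h.ne' (div_pos h1 h2).ne', Real.log_div h1.ne' h2.ne', card_permFiber]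
    ring

lemma blockEnt_eq_zero_of_card_le_one (hf : ∀ σ, 0 ≤ f σ) (hA : A.card ≤ 1) :
    blockEnt A f = 0 := by
  have h1 : A.card.factorial = 1 := Nat.factorial_eq_one.2 hA
  have h2 : ∀ σ, fiberSum A f σ = f σ := fun σ => by
    obtain ⟨τ, hτ⟩ := card_eq_one.1 ((card_permFiber A σ).trans h1)
    have := self_mem_permFiber A σ
    rw [hτ, mem_singleton] at this
    rw [fiberSum, hτ, sum_singleton, this]
  rw [blockEnt_eq hf, h1]
  simp [h2]

lemma fiberSum_of_mem {σ τ : Equiv.Perm V} (hτ : τ ∈ permFiber A σ) :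
    fiberSum A f τ = ∑ ρ ∈ permFiber A σ, f ρ := by
  rw [fiberSum, permFiber_congr hτ]

lemma fiberSum_erase_of_mem {σ τ : Equiv.Perm V} (hτ : τ ∈ permFiber A σ) {z : V} (hz : z ∈ A) :
    fiberSum (A.erase z) f τ = marg (permFiber A σ) f z (τ z) := by
  rw [fiberSum, marg, ← permFiber_congr hτ]
  congr 1
  ext ρ
  simp only [mem_permFiber, mem_filter, mem_erase, not_and_or, not_not]
  constructor
  · exact fun h => ⟨fun y hy => h y (Or.inr hy), h z (Or.inl rfl)⟩
  · rintro ⟨h1, h2⟩ y (rfl | hy)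
    exacts [h2, h1 y hy]

lemma fiberSum_erase_erase_of_mem {σ τ : Equiv.Perm V} (hτ : τ ∈ permFiber A σ) {x z : V} :
    fiberSum ((A.erase x).erase z) f τ = joint (permFiber A σ) f x z (τ x) (τ z) := by
  rw [fiberSum, joint, ← permFiber_congr hτ]
  congr 1
  ext ρ
  simp only [mem_permFiber, mem_filter, mem_erase, not_and_or, not_not]
  constructor
  · exact fun h => ⟨fun y hy => h y (Or.inr (Or.inr hy)), h x (Or.inr (Or.inl rfl)),
      h z (Or.inl rfl)⟩
  · rintro ⟨h1, h2, h3⟩ y (rfl | rfl | hy)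
    exacts [h3, h2, h1 y hy]

lemma image_eq_of_mem_permFiber {σ τ : Equiv.Perm V} (hτ : τ ∈ permFiber A σ) :
    A.image τ = A.image σ := by
  have h : ∀ σ τ : Equiv.Perm V, τ ∈ permFiber A σ → A.image τ ⊆ A.image σ := by
    intro σ τ hτ y hy
    obtain ⟨x, hx, rfl⟩ := mem_image.1 hy
    refine mem_image.2 ⟨σ⁻¹ (τ x), ?_, by simp⟩
    by_contra hn
    have := mem_permFiber.1 hτ _ hn
    rw [show σ (σ⁻¹ (τ x)) = τ x by simp] at this
    rw [τ.injective this] at hn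
    exact hn hx
  exact (h σ τ hτ).antisymm (h τ σ (mem_permFiber_comm.1 hτ))

/-- The defect in the comparison of pairwise and single-site entropies at `z`. -/
noncomputable def pairGap (A : Finset V) (f : Equiv.Perm V → ℝ) (z : V) : ℝ :=
  Real.log A.card *
      ∑ x ∈ A.erase z, (blockEnt (A.erase x) f - blockEnt ((A.erase x).erase z) f) -
    ((A.card : ℝ) - 1) * Real.log ((A.card : ℝ) - 1) * (blockEnt A f - blockEnt (A.erase z) f)

lemma log_factorial_succ (k : ℕ) :
    Real.log (k + 1).factorial = Real.log ((k : ℝ) + 1) + Real.log k.factorial := by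
  rw [Nat.factorial_succ, Nat.cast_mul, Real.log_mul (by positivity) (by positivity)]
  push_cast
  rfl

lemma blockEnt_sub_erase (hf : ∀ σ, 0 ≤ f σ) {z : V} (hz : z ∈ A) :
    blockEnt A f - blockEnt (A.erase z) f = Real.log A.card * ∑ σ, f σ +
      ∑ σ, f σ * (Real.log (fiberSum (A.erase z) f σ) - Real.log (fiberSum A f σ)) := by
  have hc := card_erase_add_one hz
  have h := log_factorial_succ (A.erase z).card
  rw [blockEnt_eq hf, blockEnt_eq hf, ← hc, h]
  simp only [mul_sub, sum_sub_distrib]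
  push_cast
  ring

lemma pairGap_eq (hf : ∀ σ, 0 ≤ f σ) {z : V} (hz : z ∈ A) :
    pairGap A f z = Real.log A.card * ∑ x ∈ A.erase z, ∑ σ, f σ *
        (Real.log (fiberSum ((A.erase x).erase z) f σ) - Real.log (fiberSum (A.erase x) f σ)) -
      ((A.card : ℝ) - 1) * Real.log ((A.card : ℝ) - 1) *
        ∑ σ, f σ * (Real.log (fiberSum (A.erase z) f σ) - Real.log (fiberSum A f σ)) := by
  have hc : ∀ x ∈ A, ((A.erase x).card : ℝ) = (A.card : ℝ) - 1 := fun x hx => by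
    rw [← card_erase_add_one hx]; simp
  rw [pairGap, blockEnt_sub_erase hf hz, sum_congr rfl fun x hx => by
    rw [blockEnt_sub_erase hf (mem_erase.2 ⟨(ne_of_mem_erase hx).symm, hz⟩),
      hc x (mem_of_mem_erase hx)]]
  rw [sum_add_distrib, sum_const, nsmul_eq_mul, hc z hz]
  ring

lemma pairGap_nonneg (hf : ∀ σ, 0 ≤ f σ) (hA : 2 ≤ A.card) {z : V} (hz : z ∈ A) :
    0 ≤ pairGap A f z := by
  rw [pairGap_eq hf hz, sub_nonneg, sum_comm]
  rw [← sum_permFiber_average A, ← sum_permFiber_average A (fun σ => ∑ x ∈ A.erase z, _),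
    mul_sum, mul_sum]
  refine sum_le_sum fun σ _ => ?_
  rw [← mul_div_assoc, ← mul_div_assoc]
  refine div_le_div_of_nonneg_right ?_ (card_permFiber_pos A σ).le
  have h := (pair_comparison (F := permFiber A σ) hf (fun τ hτ => image_eq_of_mem_permFiber hτ)
    (card_image_of_injective A σ.injective).symm hA hz).1
  refine le_trans (le_of_eq ?_) (h.trans (le_of_eq ?_))
  · congr 1
    refine sum_congr rfl fun τ hτ => ?_
    rw [fiberSum_erase_of_mem hτ hz, fiberSum_of_mem hτ]
  · congr 1
    rw [sum_comm]
    refine sum_congr rfl fun τ hτ => sum_congr rfl fun x hx => ?_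
    rw [fiberSum_erase_erase_of_mem hτ, fiberSum_erase_of_mem hτ (mem_of_mem_erase hx)]

lemma marg_of_pairGap_univ_eq_zero (hf : ∀ σ, 0 ≤ f σ) (hV : 3 ≤ Fintype.card V)
    (hM : ∑ σ, f σ ≠ 0) {z : V} (h : pairGap univ f z = 0) :
    (∃ y, marg univ f z y = ∑ σ, f σ) ∨
      ∀ y, marg univ f z y = (∑ σ, f σ) / Fintype.card V := by
  have hmem : ∀ τ : Equiv.Perm V, τ ∈ permFiber univ (1 : Equiv.Perm V) := fun τ => by
    simp [permFiber_univ]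
  rw [pairGap_eq hf (mem_univ z), sub_eq_zero] at h
  simp only [fiberSum_erase_erase_of_mem (hmem _), fiberSum_erase_of_mem (hmem _) (mem_univ _),
    fiberSum_of_mem (hmem _), permFiber_univ] at h
  have := (pair_comparison (F := univ) (A := univ) (B := univ) hf
    (fun τ _ => image_univ_of_surjective τ.surjective) rfl (by rw [card_univ]; lia)
    (mem_univ z)).2 hV hM h.symm
  simpa using this

lemma sum_pairGap_le (hA : 1 ≤ A.card)
    (ih : ∀ x ∈ A, ((A.erase x).card : ℝ) * Real.log ((A.erase x).card - 1).factorial *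
      blockEnt (A.erase x) f ≤ Real.log (A.erase x).card.factorial *
        ∑ z ∈ A.erase x, blockEnt ((A.erase x).erase z) f) :
    Real.log (A.card - 1).factorial * ∑ z ∈ A, pairGap A f z ≤
      ((A.card : ℝ) - 1) * Real.log ((A.card : ℝ) - 1) *
        (Real.log A.card.factorial * ∑ x ∈ A, blockEnt (A.erase x) f -
          A.card * Real.log (A.card - 1).factorial * blockEnt A f) := by
  obtain ⟨b, hb⟩ : ∃ b, A.card = b + 1 := ⟨A.card - 1, by lia⟩
  have hcard : ∀ x ∈ A, (A.erase x).card = b := fun x hx => by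
    rw [card_erase_of_mem hx, hb]; simp
  have hswap : ∑ z ∈ A, ∑ x ∈ A.erase z,
      (blockEnt (A.erase x) f - blockEnt ((A.erase x).erase z) f) =
      ∑ x ∈ A, (b * blockEnt (A.erase x) f -
        ∑ z ∈ A.erase x, blockEnt ((A.erase x).erase z) f) := by
    rw [sum_comm' (t' := A) (s' := fun x => A.erase x)
      (by intro x y; simp only [mem_erase]; tauto)]
    refine sum_congr rfl fun x hx => ?_
    rw [sum_sub_distrib, sum_const, hcard x hx, nsmul_eq_mul]
  have hlogb : (b : ℝ) * (Real.log b.factorial - Real.log (b - 1).factorial) = b * Real.log b := by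
    rcases b with _ | c
    · simp
    · rw [log_factorial_succ]; push_cast; simp
  have hbound : Real.log b.factorial * ∑ x ∈ A, (b * blockEnt (A.erase x) f -
        ∑ z ∈ A.erase x, blockEnt ((A.erase x).erase z) f) ≤
      b * Real.log b * ∑ x ∈ A, blockEnt (A.erase x) f := by
    rw [mul_sum, mul_sum]
    refine sum_le_sum fun x hx => ?_
    have := ih x hx
    rw [hcard x hx] at this
    rw [← hlogb]
    linarith
  have hlog : 0 ≤ Real.log ((b : ℝ) + 1) := Real.log_nonneg (by simp)
  have hmul := mul_le_mul_of_nonneg_left hbound hlog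
  simp only [pairGap]
  rw [sum_sub_distrib, ← mul_sum, ← mul_sum, hswap, sum_sub_distrib (fun _ => blockEnt A f), sum_const, hb,
    nsmul_eq_mul]
  simp only [Nat.add_sub_cancel]
  rw [log_factorial_succ]
  push_cast
  rw [add_sub_cancel_right]
  linarith

lemma log_factorial_pos {k : ℕ} (hk : 2 ≤ k) : 0 < Real.log k.factorial :=
  Real.log_pos (by exact_mod_cast Nat.one_lt_factorial.2 hk)

/-- The sharp inequality for blocks with one site removed. -/
lemma blockEnt_erase_ge (hf : ∀ σ, 0 ≤ f σ) (A : Finset V) :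
    (A.card : ℝ) * Real.log (A.card - 1).factorial * blockEnt A f ≤
      Real.log A.card.factorial * ∑ x ∈ A, blockEnt (A.erase x) f := by
  induction A using Finset.strongInduction with
  | H A ih =>
    rcases le_or_gt A.card 2 with h | h
    · have h1 : (A.card - 1).factorial = 1 := Nat.factorial_eq_one.2 (by lia)
      rw [h1, sum_eq_zero fun x hx => blockEnt_eq_zero_of_card_le_one hf
        (by rw [card_erase_of_mem hx]; lia)]
      simp
    · have h3 : (3 : ℝ) ≤ A.card := by exact_mod_cast h
      have key := sum_pairGap_le (A := A) (f := f) (by lia) fun x hx => ih _ (erase_ssubset hx)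
      have h0 : 0 ≤ Real.log (A.card - 1).factorial * ∑ z ∈ A, pairGap A f z :=
        mul_nonneg (log_factorial_pos (by lia)).le
          (sum_nonneg fun z hz => pairGap_nonneg hf (by lia) hz)
      have hpos : 0 < ((A.card : ℝ) - 1) * Real.log ((A.card : ℝ) - 1) :=
        mul_pos (by linarith) (Real.log_pos (by linarith))
      exact sub_nonneg.1 (nonneg_of_mul_nonneg_right (h0.trans key) hpos)

lemma blockEnt_univ_sub_eq_zero (hf : ∀ σ, 0 ≤ f σ) (hM : 0 < ∑ σ, f σ)
    {z : V} (h : ∀ y, marg univ f z y = (∑ σ, f σ) / Fintype.card V) :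
    blockEnt univ f - blockEnt (univ.erase z) f = 0 := by
  have hmem : ∀ τ : Equiv.Perm V, τ ∈ permFiber univ (1 : Equiv.Perm V) := fun τ => by
    simp [permFiber_univ]
  have hV : (Fintype.card V : ℝ) ≠ 0 := by
    have : Nonempty V := ⟨z⟩
    exact_mod_cast Fintype.card_ne_zero
  rw [blockEnt_sub_erase hf (mem_univ z)]
  simp only [fiberSum_erase_of_mem (hmem _) (mem_univ _), fiberSum_of_mem (hmem _),
    permFiber_univ, h]
  rw [← sum_mul, Real.log_div hM.ne' hV, card_univ]
  ring

/-- Equality for the whole set forces a point mass. -/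
lemma eq_single_of_blockEnt_erase_eq (hf : ∀ σ, 0 ≤ f σ) (hV : 3 ≤ Fintype.card V)
    (hE : blockEnt univ f ≠ 0)
    (heq : (Fintype.card V : ℝ) * Real.log (Fintype.card V - 1).factorial * blockEnt univ f =
      Real.log (Fintype.card V).factorial * ∑ x, blockEnt (univ.erase x) f) :
    ∃ (σ₀ : Equiv.Perm V) (c : ℝ), 0 < c ∧ f = fun σ => if σ = σ₀ then c else 0 := by
  obtain ⟨σ₀, hσ₀⟩ : ∃ σ, 0 < f σ := by
    by_contra! hn
    refine hE (sum_eq_zero fun σ _ => ?_)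
    rw [(hn σ).antisymm (hf σ), zero_mul]
  have hM : 0 < ∑ σ, f σ := hσ₀.trans_le (single_le_sum (fun σ _ => hf σ) (mem_univ σ₀))
  have hgap : ∀ z, pairGap univ f z = 0 := by
    have key := sum_pairGap_le (A := (univ : Finset V)) (f := f) (by rw [card_univ]; lia)
      fun x _ => blockEnt_erase_ge hf _
    rw [card_univ, heq, sub_self, mul_zero] at key
    have hnn : ∀ z ∈ (univ : Finset V), 0 ≤ pairGap univ f z := fun z hz =>
      pairGap_nonneg hf (by rw [card_univ]; lia) hz
    have hs := nonpos_of_mul_nonpos_right key (log_factorial_pos (by lia))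
    exact fun z => (sum_eq_zero_iff_of_nonneg hnn).1 (hs.antisymm (sum_nonneg hnn)) z (mem_univ z)
  have hrow := fun z => marg_of_pairGap_univ_eq_zero hf hV hM.ne' (hgap z)
  have hV' : (0 : ℝ) < Fintype.card V := by exact_mod_cast (by lia : 0 < Fintype.card V)
  by_cases hex : ∃ z y, marg univ f z y = ∑ σ, f σ
  · obtain ⟨z, y, hzy⟩ := hex
    have hdet : ∀ z y, marg univ f z y = ∑ σ, f σ → ∀ τ, 0 < f τ → τ z = y := by
      intro z y h τ hτ
      by_contra hne
      have h1 := marg_le_sub_marg (F := univ) hf z (Ne.symm hne)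
      have h2 := marg_pos (F := univ) hf (mem_univ τ) hτ z
      linarith
    have hall : ∀ x, ∃ y, marg univ f x y = ∑ σ, f σ := by
      intro x
      rcases eq_or_ne x z with rfl | hx
      · exact ⟨y, hzy⟩
      · refine (hrow x).resolve_right fun hu => ?_
        have h0 : marg univ f x y = 0 := sum_eq_zero fun τ hτ => by
          by_contra hne
          have h1 := hdet z y hzy τ (lt_of_le_of_ne (hf τ) (Ne.symm hne))
          exact hx (τ.injective ((mem_filter.1 hτ).2.trans h1.symm))
        rw [hu y] at h0
        exact (div_pos hM hV').ne' h0
    refine ⟨σ₀, f σ₀, hσ₀, funext fun τ => ?_⟩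
    split_ifs with h
    · rw [h]
    · by_contra hne
      refine h (Equiv.ext fun x => ?_)
      obtain ⟨y', hy'⟩ := hall x
      rw [hdet x y' hy' τ (lt_of_le_of_ne (hf τ) (Ne.symm hne)), hdet x y' hy' σ₀ hσ₀]
  · exfalso
    have hu : ∀ z, blockEnt (univ.erase z) f = blockEnt univ f := fun z =>
      (sub_eq_zero.1 (blockEnt_univ_sub_eq_zero hf hM
        ((hrow z).resolve_left fun h => hex ⟨z, h⟩))).symm
    obtain ⟨b, hb⟩ : ∃ b, Fintype.card V = b + 1 := ⟨Fintype.card V - 1, by lia⟩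
    simp only [hu, sum_const, card_univ, nsmul_eq_mul] at heq
    rw [hb, log_factorial_succ] at heq
    rw [hb] at hV'
    simp only [Nat.add_sub_cancel] at heq
    have hb1 : 0 < Real.log ((b : ℝ) + 1) :=
      Real.log_pos (by have : (2 : ℝ) ≤ b := by exact_mod_cast (by lia : 2 ≤ b)
                       linarith)
    have : ((b + 1 : ℕ) : ℝ) * Real.log ((b : ℝ) + 1) * blockEnt univ f = 0 := by linarith
    exact (mul_ne_zero (mul_pos hV' hb1).ne' hE) this

end Block

section Layer

variable {V : Type*} [Fintype V] [DecidableEq V] {f : Equiv.Perm V → ℝ}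

/-- The total entropy of the blocks of size `k`. -/
noncomputable def layerEnt (k : ℕ) (f : Equiv.Perm V → ℝ) : ℝ :=
  ∑ A ∈ powersetCard k univ, blockEnt A f

lemma sum_powersetCard_succ_erase (k : ℕ) (g : Finset V → ℝ) :
    ∑ A ∈ powersetCard (k + 1) univ, ∑ x ∈ A, g (A.erase x) =
      ((Fintype.card V : ℝ) - k) * ∑ A ∈ powersetCard k univ, g A := by
  have h : ∑ A ∈ powersetCard (k + 1) (univ : Finset V), ∑ x ∈ A, g (A.erase x) =
      ∑ B ∈ powersetCard k (univ : Finset V), ∑ _x ∈ Bᶜ, g B := by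
    rw [sum_sigma', sum_sigma']
    refine sum_bij' (fun P _ => ⟨P.1.erase P.2, P.2⟩) (fun P _ => ⟨insert P.2 P.1, P.2⟩)
      ?_ ?_ ?_ ?_ ?_
    · rintro ⟨A, x⟩ h
      simp only [mem_sigma, mem_powersetCard_univ] at h
      simp [mem_powersetCard_univ, card_erase_of_mem h.2, h.1]
    · rintro ⟨B, x⟩ h
      simp only [mem_sigma, mem_powersetCard_univ, mem_compl] at h
      simp [mem_powersetCard_univ, card_insert_of_notMem h.2, h.1]
    · rintro ⟨A, x⟩ h
      simp only [mem_sigma] at h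
      simp [insert_erase h.2]
    · rintro ⟨B, x⟩ h
      simp only [mem_sigma, mem_compl] at h
      simp [erase_insert h.2]
    · rintro ⟨A, x⟩ _
      rfl
  rw [h, mul_sum]
  refine sum_congr rfl fun B hB => ?_
  have hB' := mem_powersetCard_univ.1 hB
  rw [sum_const, nsmul_eq_mul, card_compl, Nat.cast_sub (card_le_univ B), hB']

lemma layerEnt_succ_le (hf : ∀ σ, 0 ≤ f σ) (k : ℕ) :
    ((k : ℝ) + 1) * Real.log k.factorial * layerEnt (k + 1) f ≤
      Real.log (k + 1).factorial * (((Fintype.card V : ℝ) - k) * layerEnt k f) := by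
  rw [layerEnt, layerEnt, ← sum_powersetCard_succ_erase, mul_sum, mul_sum]
  refine sum_le_sum fun A hA => ?_
  have := blockEnt_erase_ge hf A
  rw [mem_powersetCard_univ.1 hA] at this
  simpa using this

lemma layerEnt_ge_of_ge (hf : ∀ σ, 0 ≤ f σ) {m : ℕ} (hm : m ≤ Fintype.card V) {d : ℝ}
    (h : ((Fintype.card V).choose m : ℝ) * Real.log m.factorial * d ≤ layerEnt m f) {k : ℕ}
    (hk : 2 ≤ k) (hkm : k ≤ m) :
    ((Fintype.card V).choose k : ℝ) * Real.log k.factorial * d ≤ layerEnt k f := by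
  induction hkm using Nat.decreasingInduction with
  | self => exact h
  | of_succ j hj ih =>
    have ih := ih (by lia)
    have hstep := layerEnt_succ_le hf j
    have hlog := log_factorial_pos (k := j) hk
    have hlog' := log_factorial_pos (k := j + 1) (by lia)
    have hcard : (0 : ℝ) < (Fintype.card V : ℝ) - j := by
      rw [sub_pos]; exact_mod_cast (by lia : j < Fintype.card V)
    have hch : ((Fintype.card V).choose (j + 1) : ℝ) * ((j : ℝ) + 1) =
        ((Fintype.card V).choose j : ℝ) * ((Fintype.card V : ℝ) - j) := by
      have := Nat.choose_succ_right_eq (Fintype.card V) j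
      rw [← Nat.cast_sub (by lia : j ≤ Fintype.card V)]
      exact_mod_cast this
    have h1 := mul_le_mul_of_nonneg_left ih (mul_nonneg (by positivity : (0 : ℝ) ≤ (j : ℝ) + 1) hlog.le)
    have h2 := h1.trans hstep
    have h3 : Real.log (j + 1).factorial * ((Fintype.card V : ℝ) - j) *
        (((Fintype.card V).choose j : ℝ) * Real.log j.factorial * d) ≤
        Real.log (j + 1).factorial * ((Fintype.card V : ℝ) - j) * layerEnt j f := by
      refine le_trans (le_of_eq ?_) (h2.trans (le_of_eq (by ring)))
      linear_combination (-(Real.log j.factorial * Real.log (j + 1).factorial * d)) * hch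
    exact le_of_mul_le_mul_left h3 (mul_pos hlog' hcard)

lemma layerEnt_card (f : Equiv.Perm V → ℝ) : layerEnt (Fintype.card V) f = blockEnt univ f := by
  rw [layerEnt, ← card_univ, powersetCard_self, sum_singleton]

lemma layerEnt_ge (hf : ∀ σ, 0 ≤ f σ) {k : ℕ} (hk : 2 ≤ k) (hkn : k ≤ Fintype.card V) :
    ((Fintype.card V).choose k : ℝ) * Real.log k.factorial *
      (blockEnt univ f / Real.log (Fintype.card V).factorial) ≤ layerEnt k f := by
  refine layerEnt_ge_of_ge hf le_rfl (le_of_eq ?_) hk hkn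
  have := (log_factorial_pos (hk.trans hkn)).ne'
  rw [layerEnt_card, Nat.choose_self]
  field_simp
  simp

lemma layerEnt_card_pred (hV : 1 ≤ Fintype.card V) (f : Equiv.Perm V → ℝ) :
    layerEnt (Fintype.card V - 1) f = ∑ x, blockEnt (univ.erase x) f := by
  have h := sum_powersetCard_succ_erase (Fintype.card V - 1) fun A : Finset V => blockEnt A f
  rw [Nat.sub_add_cancel hV, Nat.cast_sub hV, ← card_univ, powersetCard_self, sum_singleton] at h
  rw [h, card_univ, layerEnt]
  simp

/-- Equality in one layer of blocks of size less than `|V|` forces a point mass. -/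
lemma eq_single_of_layerEnt_eq (hf : ∀ σ, 0 ≤ f σ) {k : ℕ} (hk : 2 ≤ k)
    (hkn : k < Fintype.card V) (hE : blockEnt univ f ≠ 0)
    (h : ((Fintype.card V).choose k : ℝ) * Real.log k.factorial *
      (blockEnt univ f / Real.log (Fintype.card V).factorial) = layerEnt k f) :
    ∃ (σ₀ : Equiv.Perm V) (c : ℝ), 0 < c ∧ f = fun σ => if σ = σ₀ then c else 0 := by
  set n := Fintype.card V with hn
  refine eq_single_of_blockEnt_erase_eq hf (by lia) hE ?_
  have h1 := blockEnt_erase_ge hf (univ : Finset V)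
  rw [card_univ, ← hn] at h1
  have hl : 0 < Real.log (n - 1).factorial := log_factorial_pos (by lia)
  have hl' : 0 < Real.log n.factorial := log_factorial_pos (by lia)
  have hlk : 0 < Real.log k.factorial := log_factorial_pos hk
  have hn0 : (0 : ℝ) < n := by exact_mod_cast (by lia : 0 < n)
  have hch : (n.choose (n - 1) : ℝ) = n := by
    obtain ⟨b, hb⟩ : ∃ b, n = b + 1 := ⟨n - 1, by lia⟩
    rw [hb]; simp
  have h2 := layerEnt_ge_of_ge hf (m := n - 1)
    (d := layerEnt (n - 1) f / (n * Real.log (n - 1).factorial)) (by lia)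
    (le_of_eq (by rw [← hn, hch]; field_simp)) hk (by lia)
  rw [← hn, ← h] at h2
  have hpos : 0 < (n.choose k : ℝ) * Real.log k.factorial :=
    mul_pos (by exact_mod_cast Nat.choose_pos hkn.le) hlk
  have h3 := le_of_mul_le_mul_left h2 hpos
  rw [layerEnt_card_pred (by lia), div_le_div_iff₀ (by positivity) hl'] at h3
  refine h1.antisymm ?_
  linarith

lemma sum_block_weights (w : ℕ → ℝ) (g : Finset V → ℝ) :
    ∑ A : Finset V, (if 2 ≤ A.card then w A.card else 0) * g A =
      ∑ k ∈ Icc 2 (Fintype.card V), w k * ∑ A ∈ powersetCard k univ, g A := by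
  have h : ∑ A : Finset V, (if 2 ≤ A.card then w A.card else 0) * g A =
      ∑ A ∈ univ.filter (fun A : Finset V => 2 ≤ A.card), w A.card * g A := by
    rw [sum_filter]
    exact sum_congr rfl fun A _ => by split_ifs <;> simp
  rw [h, ← sum_fiberwise_of_maps_to (t := Icc 2 (Fintype.card V)) (g := card)
    (fun A hA => mem_Icc.2 ⟨(mem_filter.1 hA).2, card_le_univ A⟩)]
  refine sum_congr rfl fun k hk => ?_
  rw [mul_sum]
  refine sum_congr ?_ fun A hA => by rw [mem_powersetCard_univ.1 hA]
  ext A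
  simp only [mem_filter, mem_univ, true_and, mem_powersetCard_univ]
  have := (mem_Icc.1 hk).1
  lia

lemma blockEnt_single (A : Finset V) (σ₀ : Equiv.Perm V) :
    blockEnt A (fun σ => if σ = σ₀ then (1 : ℝ) else 0) = Real.log A.card.factorial := by
  have hs : fiberSum A (fun σ => if σ = σ₀ then (1 : ℝ) else 0) σ₀ = 1 := by
    simp [fiberSum, self_mem_permFiber]
  rw [blockEnt_eq fun σ => by positivity]
  simp [hs]

end Layer

end Stmt4

open Stmt4 in
theorem stmt4 {V : Type*} [Fintype V] [DecidableEq V]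
    (n : ℕ) (hn : 2 ≤ n) (hcard : Fintype.card V = n)
    (w : ℕ → ℝ) (hw : ∀ ℓ, 0 ≤ w ℓ)
    (α : Finset V → ℝ) (hα : ∀ A : Finset V, α A = if 2 ≤ A.card then w A.card else 0)
    (κ : ℝ)
    (hκ : κ = (∑ ℓ ∈ Finset.Icc 2 n,
        w ℓ * (Nat.choose n ℓ : ℝ) * Real.log (Nat.factorial ℓ)) / Real.log (Nat.factorial n)) :
    -- (i) the entropy inequality holds with constant κ
    (∀ f : Equiv.Perm V → ℝ, (∀ σ, 0 ≤ f σ) →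
        κ * Ent f ≤ ∑ A : Finset V, α A * mean (EntA A f))
    -- (ii) the indicator of any single permutation achieves equality
    ∧ (∀ σ₀ : Equiv.Perm V,
        κ * Ent (fun σ => if σ = σ₀ then (1 : ℝ) else 0)
          = ∑ A : Finset V, α A * mean (EntA A (fun σ => if σ = σ₀ then (1 : ℝ) else 0)))
    -- (iii) uniqueness of the optimizers
    ∧ ((∃ ℓ ∈ Finset.Icc 2 (n - 1), 0 < w ℓ) →
        ∀ f : Equiv.Perm V → ℝ, (∀ σ, 0 ≤ f σ) → Ent f ≠ 0 →
          κ * Ent f = ∑ A : Finset V, α A * mean (EntA A f) →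
          ∃ (σ₀ : Equiv.Perm V) (c : ℝ), 0 < c ∧ f = fun σ => if σ = σ₀ then c else 0) := by
  subst hcard
  have hN : (0 : ℝ) < Fintype.card (Equiv.Perm V) := by exact_mod_cast Fintype.card_pos
  have hlog := log_factorial_pos hn
  have hrhs : ∀ f : Equiv.Perm V → ℝ, ∑ A : Finset V, α A * mean (EntA A f) =
      (∑ k ∈ Icc 2 (Fintype.card V), w k * layerEnt k f) / Fintype.card (Equiv.Perm V) := by
    intro f
    simp only [layerEnt]
    rw [← sum_block_weights, sum_div]
    refine sum_congr rfl fun A _ => ?_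
    rw [hα, mean_EntA, mul_div_assoc]
  have hlhs : ∀ f : Equiv.Perm V → ℝ, κ * Ent f =
      (∑ k ∈ Icc 2 (Fintype.card V), w k * (((Fintype.card V).choose k : ℝ) *
        Real.log k.factorial * (blockEnt univ f / Real.log (Fintype.card V).factorial))) /
        Fintype.card (Equiv.Perm V) := by
    intro f
    rw [hκ, Ent_eq_blockEnt, ← mul_div_assoc, div_mul_eq_mul_div, mul_div_assoc, sum_mul]
    congr 1
    exact sum_congr rfl fun k _ => by ring
  have hterm : ∀ f : Equiv.Perm V → ℝ, (∀ σ, 0 ≤ f σ) → ∀ k ∈ Icc 2 (Fintype.card V),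
      w k * (((Fintype.card V).choose k : ℝ) * Real.log k.factorial *
        (blockEnt univ f / Real.log (Fintype.card V).factorial)) ≤ w k * layerEnt k f :=
    fun f hf k hk => mul_le_mul_of_nonneg_left
      (layerEnt_ge hf (mem_Icc.1 hk).1 (mem_Icc.1 hk).2) (hw k)
  refine ⟨fun f hf => ?_, fun σ₀ => ?_, ?_⟩
  · rw [hrhs, hlhs]
    exact div_le_div_of_nonneg_right (sum_le_sum (hterm f hf)) hN.le
  · rw [hrhs, hlhs, blockEnt_single, card_univ, div_self hlog.ne']
    congr 1
    refine sum_congr rfl fun k _ => ?_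
    rw [layerEnt, sum_congr rfl fun A hA => by
      rw [blockEnt_single, mem_powersetCard_univ.1 hA], sum_const, card_powersetCard, card_univ,
      nsmul_eq_mul, mul_one]
  · rintro ⟨k, hk, hwk⟩ f hf hE heq
    obtain ⟨hk2, hkn⟩ := mem_Icc.1 hk
    rw [hrhs, hlhs, div_left_inj' hN.ne'] at heq
    have hk' := (sum_eq_sum_iff_of_le (hterm f hf)).1 heq k (mem_Icc.2 ⟨hk2, by lia⟩)
    refine eq_single_of_layerEnt_eq hf hk2 (by lia) (fun h => hE ?_)
      (mul_left_cancel₀ hwk.ne' hk')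
    rw [Ent_eq_blockEnt, h, zero_div]
end
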